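/- arXiv:1702.05760 — 8 statements merged into one kernel-verified Lean document; each statement's English description precedes it below -/
import Mathlib

section
/- For d = 2 (square LSH), the hypercube-LSH collision probability is exactly p_2(θ) = 1 − 2θ/π for θ ∈ [0, π/2], and p_2(θ) = 0 for θ ∈ (π/2, π]. -/
open MeasureTheory Real Filter

noncomputable section

instance (d : ℕ) : MeasurableSpace (Matrix (Fin d) (Fin d) ℝ) := MeasurableSpace.pi

/-- The sign function: `+1` if `t ≥ 0` and `-1` if `t < 0`. -/
def sgn (t : ℝ) : ℝ := if 0 ≤ t then 1 else -1

/-- The unit vector `x = e₁` in `ℝ^d`. -/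
def xvec (d : ℕ) : Fin d → ℝ := fun i => if (i : ℕ) = 0 then 1 else 0

/-- The unit vector `y = (cos θ) e₁ + (sin θ) e₂` in `ℝ^d`. -/
def yvec (d : ℕ) (θ : ℝ) : Fin d → ℝ :=
  fun i => if (i : ℕ) = 0 then Real.cos θ else if (i : ℕ) = 1 then Real.sin θ else 0

/-- The event that the hypercube hashes of `x` and `y` coincide:
`h_A(x) = h_A(y)` where `h_A(v) = (sgn((Av)₁), …, sgn((Av)_d))`. -/
def collisionEvent (d : ℕ) (θ : ℝ) : Set (Matrix.orthogonalGroup (Fin d) ℝ) :=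
  {A | ∀ i : Fin d,
    sgn (((A : Matrix (Fin d) (Fin d) ℝ).mulVec (xvec d)) i)
      = sgn (((A : Matrix (Fin d) (Fin d) ℝ).mulVec (yvec d θ)) i)}

/-- The hypercube-LSH collision probability `p_d(θ)`, where `μ` is the Haar probability
measure on the orthogonal group `O(d)`. -/
def collProb (d : ℕ) (θ : ℝ) (μ : Measure (Matrix.orthogonalGroup (Fin d) ℝ)) : ℝ :=
  (μ (collisionEvent d θ)).toReal

/-- rotation matrix -/
def rotM (t : ℝ) : Matrix (Fin 2) (Fin 2) ℝ := !![cos t, -sin t; sin t, cos t]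

lemma rotM_mem (t : ℝ) : rotM t ∈ Matrix.orthogonalGroup (Fin 2) ℝ := by
  rw [Matrix.mem_orthogonalGroup_iff]
  ext i j
  have := sin_sq_add_cos_sq t
  fin_cases i <;> fin_cases j <;> simp [rotM, Matrix.mul_apply, Fin.sum_univ_two] <;> nlinarith

def rot (t : ℝ) : Matrix.orthogonalGroup (Fin 2) ℝ := ⟨rotM t, rotM_mem t⟩

lemma meas_entry (i j : Fin 2) :
    Measurable (fun A : Matrix.orthogonalGroup (Fin 2) ℝ => (A : Matrix (Fin 2) (Fin 2) ℝ) i j) := by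
  have h1 : Measurable (fun M : Matrix (Fin 2) (Fin 2) ℝ => M i j) :=
    (measurable_pi_apply j).comp (measurable_pi_apply (X := fun _ : Fin 2 => Fin 2 → ℝ) i)
  exact h1.comp measurable_subtype_coe

lemma meas_sgn : Measurable sgn :=
  Measurable.ite measurableSet_Ici measurable_const measurable_const

lemma coll_iff (θ : ℝ) (A : Matrix.orthogonalGroup (Fin 2) ℝ) :
    A ∈ collisionEvent 2 θ ↔
      (sgn (A.1 0 0) = sgn (A.1 0 0 * cos θ + A.1 0 1 * sin θ) ∧
       sgn (A.1 1 0) = sgn (A.1 1 0 * cos θ + A.1 1 1 * sin θ)) := by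
  simp [collisionEvent, Fin.forall_fin_two, Matrix.mulVec, dotProduct, Fin.sum_univ_two, xvec, yvec]

lemma meas_coll (θ : ℝ) : MeasurableSet (collisionEvent 2 θ) := by
  have : collisionEvent 2 θ = {A | sgn (A.1 0 0) = sgn (A.1 0 0 * cos θ + A.1 0 1 * sin θ)} ∩
       {A | sgn (A.1 1 0) = sgn (A.1 1 0 * cos θ + A.1 1 1 * sin θ)} := by
    ext A; exact coll_iff θ A
  rw [this]
  have m := meas_entry
  exact (measurableSet_eq_fun (meas_sgn.comp (m 0 0))
    (meas_sgn.comp (((m 0 0).mul_const _).add ((m 0 1).mul_const _)))).inter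
    (measurableSet_eq_fun (meas_sgn.comp (m 1 0))
    (meas_sgn.comp (((m 1 0).mul_const _).add ((m 1 1).mul_const _))))

lemma meas_act : Measurable (fun p : ℝ × Matrix.orthogonalGroup (Fin 2) ℝ => rot p.1 * p.2) := by
  apply Measurable.subtype_mk (f := fun p : ℝ × Matrix.orthogonalGroup (Fin 2) ℝ => rotM p.1 * p.2.1)
  have m : ∀ i j, Measurable (fun p : ℝ × Matrix.orthogonalGroup (Fin 2) ℝ => p.2.1 i j) :=
    fun i j => (meas_entry i j).comp measurable_snd
  have hc : Measurable (fun p : ℝ × Matrix.orthogonalGroup (Fin 2) ℝ => cos p.1) :=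
    measurable_cos.comp measurable_fst
  have hs : Measurable (fun p : ℝ × Matrix.orthogonalGroup (Fin 2) ℝ => sin p.1) :=
    measurable_sin.comp measurable_fst
  refine measurable_pi_iff.2 fun i => measurable_pi_iff.2 fun j => ?_
  fin_cases i
  · have : Measurable (fun p : ℝ × Matrix.orthogonalGroup (Fin 2) ℝ =>
      cos p.1 * p.2.1 0 j + (-sin p.1) * p.2.1 1 j) := (hc.mul (m 0 j)).add (hs.neg.mul (m 1 j))
    convert this using 2 with p
    simp [rotM, Matrix.mul_apply, Fin.sum_univ_two]
  · have : Measurable (fun p : ℝ × Matrix.orthogonalGroup (Fin 2) ℝ =>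
      sin p.1 * p.2.1 0 j + (cos p.1) * p.2.1 1 j) := (hs.mul (m 0 j)).add (hc.mul (m 1 j))
    convert this using 2 with p
    simp [rotM, Matrix.mul_apply, Fin.sum_univ_two]

lemma meas_left (t : ℝ) :
    Measurable (fun A : Matrix.orthogonalGroup (Fin 2) ℝ => rot t * A) := by
  have h1 : Measurable (fun A : Matrix.orthogonalGroup (Fin 2) ℝ => (t, A)) :=
    measurable_prodMk_left
  have h2 := meas_act.comp h1
  have e : ((fun p : ℝ × Matrix.orthogonalGroup (Fin 2) ℝ => rot p.1 * p.2) ∘ fun A => (t, A)) =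
    fun A => rot t * A := by funext A; rfl
  rw [e] at h2
  exact h2

lemma param (θ : ℝ) (A : Matrix.orthogonalGroup (Fin 2) ℝ) :
    ∃ φ ε : ℝ, (ε = 1 ∨ ε = -1) ∧ ∀ t, rot t * A ∈ collisionEvent 2 θ ↔
      (sgn (cos (t + φ)) = sgn (cos (t + φ + ε * θ)) ∧
       sgn (sin (t + φ)) = sgn (sin (t + φ + ε * θ))) := by
  have hA := (Matrix.mem_orthogonalGroup_iff' (Fin 2) ℝ).1 A.2
  have h00 := congrFun (congrFun hA 0) 0
  have h01 := congrFun (congrFun hA 0) 1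
  have h11 := congrFun (congrFun hA 1) 1
  simp [Matrix.mul_apply, Fin.sum_univ_two] at h00 h01 h11
  set a := A.1 0 0 with ha
  set b := A.1 0 1 with hb
  set c := A.1 1 0 with hc
  set d := A.1 1 1 with hd
  have hn : ‖(⟨a, c⟩ : ℂ)‖ = 1 := by
    rw [Complex.norm_def, Complex.normSq_mk, h00, sqrt_one]
  have h0 : (⟨a, c⟩ : ℂ) ≠ 0 := by
    intro h; rw [h] at hn; simp at hn
  have hcos := Complex.cos_arg h0
  have hsin := Complex.sin_arg (⟨a, c⟩ : ℂ)
  rw [hn] at hcos hsin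
  simp only [div_one] at hcos hsin
  set φ := Complex.arg ⟨a, c⟩
  have eb : b = -(a * d - b * c) * c := by linear_combination (-b) * h00 + a * h01
  have ed : d = (a * d - b * c) * a := by linear_combination (-d) * h00 + c * h01
  have he : (a * d - b * c) = 1 ∨ (a * d - b * c) = -1 := by
    have : (a * d - b * c)^2 = 1 := by linear_combination (b*b+d*d) * h00 + h11 - (a*b+c*d) * h01
    simpa using this
  refine ⟨φ, a * d - b * c, he, fun t => ?_⟩
  set ε := a * d - b * c
  have ecos : cos (ε * θ) = cos θ := by rcases he with h | h <;> rw [h] <;> simp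
  have esin : sin (ε * θ) = ε * sin θ := by rcases he with h | h <;> rw [h] <;> simp
  have r0 : (rot t * A).1 0 0 = cos (t + φ) := by
    have : (rot t * A).1 0 0 = cos t * a + -sin t * c := by
      simp [rot, rotM, Matrix.mul_apply, Fin.sum_univ_two, a, c]
    rw [this, cos_add, hcos, hsin]; ring
  have r1 : (rot t * A).1 1 0 = sin (t + φ) := by
    have : (rot t * A).1 1 0 = sin t * a + cos t * c := by
      simp [rot, rotM, Matrix.mul_apply, Fin.sum_univ_two, a, c]
    rw [this, sin_add, hcos, hsin]
  have r2 : (rot t * A).1 0 1 = -ε * sin (t + φ) := by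
    have : (rot t * A).1 0 1 = cos t * b + -sin t * d := by
      simp [rot, rotM, Matrix.mul_apply, Fin.sum_univ_two, b, d]
    rw [this, sin_add, hcos, hsin]; linear_combination cos t * eb - sin t * ed
  have r3 : (rot t * A).1 1 1 = ε * cos (t + φ) := by
    have : (rot t * A).1 1 1 = sin t * b + cos t * d := by
      simp [rot, rotM, Matrix.mul_apply, Fin.sum_univ_two, b, d]
    rw [this, cos_add, hcos, hsin]; linear_combination sin t * eb + cos t * ed
  rw [coll_iff, r0, r1, r2, r3, cos_add (t + φ), sin_add (t + φ), ecos, esin]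
  have q1 : cos (t + φ) * cos θ + -ε * sin (t + φ) * sin θ =
    cos (t + φ) * cos θ - sin (t + φ) * (ε * sin θ) := by ring
  have q2 : sin (t + φ) * cos θ + ε * cos (t + φ) * sin θ =
    sin (t + φ) * cos θ + cos (t + φ) * (ε * sin θ) := by ring
  rw [q1, q2]

/-- the quarter-periodic version of the indicator -/
def gfun (θ s : ℝ) : ℝ :=
  if 0 < cos s * cos (s + θ) ∧ 0 < sin s * sin (s + θ) then 1 else 0

lemma gfun_periodic (θ : ℝ) : Function.Periodic (gfun θ) (π/2) := by
  intro s
  have e : s + π/2 + θ = (s + θ) + π/2 := by ring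
  unfold gfun
  rw [e, cos_add_pi_div_two, cos_add_pi_div_two, sin_add_pi_div_two, sin_add_pi_div_two, neg_mul_neg]
  simp only [and_comm]

lemma gfun_int (θ : ℝ) (h0 : 0 ≤ θ) (h1 : θ ≤ π) :
    ∫ s in (0:ℝ)..(π/2), gfun θ s = max (π/2 - θ) 0 := by
  have hp := pi_pos
  rw [intervalIntegral.integral_of_le (by linarith), integral_Ioc_eq_integral_Ioo]
  have : Set.EqOn (gfun θ) ((Set.Iio (π/2 - θ)).indicator 1) (Set.Ioo 0 (π/2)) := by
    rintro s ⟨hs0, hs1⟩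
    have c1 : 0 < cos s := cos_pos_of_mem_Ioo ⟨by linarith, hs1⟩
    have c2 : 0 < sin s := sin_pos_of_pos_of_lt_pi hs0 (by linarith)
    by_cases h : s < π/2 - θ
    · have c3 : 0 < cos (s + θ) := cos_pos_of_mem_Ioo ⟨by linarith, by linarith⟩
      have c4 : 0 < sin (s + θ) := sin_pos_of_pos_of_lt_pi (by linarith) (by linarith)
      simp [gfun, h, mul_pos c1 c3, mul_pos c2 c4]
    · have c3 : cos (s + θ) ≤ 0 := cos_nonpos_of_pi_div_two_le_of_le (by linarith) (by linarith)
      have : ¬ (0 < cos s * cos (s + θ)) := not_lt.2 (mul_nonpos_of_nonneg_of_nonpos c1.le c3)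
      simp [gfun, h, this]
  rw [setIntegral_congr_fun measurableSet_Ioo this, integral_indicator_one measurableSet_Iio,
    measureReal_restrict_apply measurableSet_Iio]
  have : Set.Iio (π/2 - θ) ∩ Set.Ioo 0 (π/2) = Set.Ioo 0 (π/2 - θ) := by
    ext s; simp only [Set.mem_inter_iff, Set.mem_Iio, Set.mem_Ioo]
    constructor
    · rintro ⟨a, b, c⟩; exact ⟨b, a⟩
    · rintro ⟨a, b⟩; exact ⟨b, a, by linarith⟩
  rw [this, Measure.real, Real.volume_Ioo, sub_zero, ENNReal.toReal_ofReal']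

lemma sgn_iff {a b : ℝ} (ha : a ≠ 0) (hb : b ≠ 0) : sgn a = sgn b ↔ 0 < a * b := by
  unfold sgn
  rcases lt_or_gt_of_ne ha with h | h <;> rcases lt_or_gt_of_ne hb with h' | h'
  · simp [h.not_ge, h'.not_ge, mul_pos_of_neg_of_neg h h']
  · simp [h.not_ge, h'.le]; norm_num; exact (mul_neg_of_neg_of_pos h h').le
  · simp [h.le, h'.not_ge]; norm_num; exact (mul_neg_of_pos_of_neg h h').le
  · simp [h.le, h'.le, mul_pos h h']

lemma ae_sin (c : ℝ) : ∀ᵐ t : ℝ, sin (t + c) ≠ 0 := by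
  rw [ae_iff]
  apply Set.Countable.measure_zero
  refine (Set.countable_range (fun n : ℤ => n * π - c)).mono ?_
  intro t ht
  simp only [ne_eq, not_not, Set.mem_ofPred_eq] at ht
  obtain ⟨n, hn⟩ := sin_eq_zero_iff.1 ht
  exact ⟨n, by simp only [hn]; ring⟩

lemma ae_cos (c : ℝ) : ∀ᵐ t : ℝ, cos (t + c) ≠ 0 := by
  filter_upwards [ae_sin (c + π/2)] with t ht
  rwa [← add_assoc, sin_add_pi_div_two] at ht

lemma integ (θ ψ : ℝ) (h0 : 0 ≤ θ) (h1 : θ ≤ π) :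
    (volume.restrict (Set.Ioc 0 (π/2))) {t : ℝ | sgn (cos (t + ψ)) = sgn (cos (t + ψ + θ)) ∧
       sgn (sin (t + ψ)) = sgn (sin (t + ψ + θ))} = ENNReal.ofReal (π/2 - θ) := by
  have hp := pi_pos
  set T := {t : ℝ | sgn (cos (t + ψ)) = sgn (cos (t + ψ + θ)) ∧
       sgn (sin (t + ψ)) = sgn (sin (t + ψ + θ))} with hT
  have mT : MeasurableSet T := by
    have m1 : ∀ c : ℝ, Measurable fun t : ℝ => t + c := fun c => measurable_id.add_const c
    exact (measurableSet_eq_fun (meas_sgn.comp (measurable_cos.comp (m1 ψ)))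
      (meas_sgn.comp (measurable_cos.comp ((m1 ψ).add_const θ)))).inter
      (measurableSet_eq_fun (meas_sgn.comp (measurable_sin.comp (m1 ψ)))
      (meas_sgn.comp (measurable_sin.comp ((m1 ψ).add_const θ))))
  have hr : (volume.restrict (Set.Ioc 0 (π/2))).real T = max (π/2 - θ) 0 := by
    rw [← integral_indicator_one mT, ← intervalIntegral.integral_of_le (by linarith),
      ← gfun_int θ h0 h1]
    have e1 : ∫ t in (0:ℝ)..(π/2), T.indicator (1 : ℝ → ℝ) t =
        ∫ t in (0:ℝ)..(π/2), gfun θ (t + ψ) := by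
      apply intervalIntegral.integral_congr_ae
      filter_upwards [ae_sin ψ, ae_cos ψ, ae_sin (ψ + θ), ae_cos (ψ + θ)] with t a1 a2 a3 a4 _
      rw [← add_assoc] at a3 a4
      simp only [Set.indicator, hT, Set.mem_ofPred_eq, gfun, sgn_iff a1 a3, sgn_iff a2 a4,
        Pi.one_apply]
    rw [e1, intervalIntegral.integral_comp_add_right (gfun θ)]
    have := (gfun_periodic θ).intervalIntegral_add_eq ψ 0
    rw [zero_add] at this ⊢
    rw [← this, add_comm]
  rw [← ENNReal.toReal_ofReal', Measure.real] at hr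
  exact (ENNReal.toReal_eq_toReal_iff' (measure_ne_top _ _) ENNReal.ofReal_ne_top).1 hr

lemma integ' (θ φ ε : ℝ) (he : ε = 1 ∨ ε = -1) (h0 : 0 ≤ θ) (h1 : θ ≤ π) :
    (volume.restrict (Set.Ioc 0 (π/2))) {t : ℝ | sgn (cos (t + φ)) = sgn (cos (t + φ + ε * θ)) ∧
       sgn (sin (t + φ)) = sgn (sin (t + φ + ε * θ))} = ENNReal.ofReal (π/2 - θ) := by
  rcases he with rfl | rfl
  · simpa using integ θ φ h0 h1
  · rw [← integ θ (φ - θ) h0 h1]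
    congr 1
    ext t
    have e1 : t + (φ - θ) + θ = t + φ := by ring
    have e2 : t + φ + -1 * θ = t + (φ - θ) := by ring
    simp only [Set.mem_ofPred_eq, e1, e2]
    constructor <;> rintro ⟨h, h'⟩ <;> exact ⟨h.symm, h'.symm⟩

lemma key (μ : Measure (Matrix.orthogonalGroup (Fin 2) ℝ))
    (hHaar : μ.IsHaarMeasure) (hProb : IsProbabilityMeasure μ) (θ : ℝ) (h0 : 0 ≤ θ) (h1 : θ ≤ π) :
    μ (collisionEvent 2 θ) * ENNReal.ofReal (π/2) = ENNReal.ofReal (π/2 - θ) := by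
  let S : Set (ℝ × Matrix.orthogonalGroup (Fin 2) ℝ) :=
    (fun p => rot p.1 * p.2) ⁻¹' collisionEvent 2 θ
  have hS : MeasurableSet S := meas_act (meas_coll θ)
  have e1 := Measure.prod_apply (μ := volume.restrict (Set.Ioc 0 (π/2))) (ν := μ) hS
  have e2 := Measure.prod_apply_symm (μ := volume.restrict (Set.Ioc 0 (π/2))) (ν := μ) hS
  rw [e1] at e2
  have f1 : ∀ t, μ (Prod.mk t ⁻¹' S) = μ (collisionEvent 2 θ) := by
    intro t
    have hm : Measurable (fun A : Matrix.orthogonalGroup (Fin 2) ℝ => rot t * A) :=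
      meas_left t
    conv_rhs => rw [← hHaar.toIsMulLeftInvariant.map_mul_left_eq_self (rot t)]
    rw [Measure.map_apply hm (meas_coll θ)]
    rfl
  have f2 : ∀ A, (volume.restrict (Set.Ioc 0 (π/2))) ((fun t => (t, A)) ⁻¹' S)
      = ENNReal.ofReal (π/2 - θ) := by
    intro A
    obtain ⟨φ, ε, he, h⟩ := param θ A
    rw [← integ' θ φ ε he h0 h1]
    congr 1
    ext t
    exact h t
  simp only [f1, f2, lintegral_const, measure_univ, mul_one] at e2
  simpa using e2

theorem square_lsh_collision_prob
    (μ : Measure (Matrix.orthogonalGroup (Fin 2) ℝ))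
    (hHaar : μ.IsHaarMeasure) (hProb : IsProbabilityMeasure μ) :
    (∀ θ ∈ Set.Icc (0 : ℝ) (π / 2), collProb 2 θ μ = 1 - 2 * θ / π) ∧
    (∀ θ ∈ Set.Ioc (π / 2) π, collProb 2 θ μ = 0) := by
  have hp := pi_pos
  constructor
  · rintro θ ⟨h0, h1⟩
    have := congrArg ENNReal.toReal (key μ hHaar hProb θ h0 (by linarith))
    rw [ENNReal.toReal_mul, ENNReal.toReal_ofReal (by linarith),
      ENNReal.toReal_ofReal (by linarith)] at this
    unfold collProb
    field_simp
    linarith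
  · rintro θ ⟨h0, h1⟩
    have := congrArg ENNReal.toReal (key μ hHaar hProb θ (by linarith) h1)
    rw [ENNReal.toReal_mul, ENNReal.toReal_ofReal (by linarith),
      ENNReal.ofReal_of_nonpos (by linarith)] at this
    unfold collProb
    have h2 : π / 2 ≠ 0 := by positivity
    simpa [h2, hp.ne'] using this
end
end

section
/- For every θ with 2/π < cos θ < 1, there exists exactly one real number β₀ ∈ (1, ∞) such that β₀ cos θ > 1 and arccos(−1/β₀) = (β₀ − cos θ)·√(β₀² − 1) / (β₀·(β₀ cos θ − 1)). -/
open Real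

theorem aux_iff (c s : ℝ) (hs0 : 0 < s) (hs1 : s < π / 2) (hc : Real.sin s < c) :
    Real.arccos (-1 / (1 / Real.sin s))
        = (1 / Real.sin s - c) * Real.sqrt ((1 / Real.sin s) ^ 2 - 1) /
          ((1 / Real.sin s) * ((1 / Real.sin s) * c - 1)) ↔
    (1 - c * Real.sin s) * Real.cos s / (c - Real.sin s) - s = π / 2 := by
  have hx : 0 < Real.sin s := Real.sin_pos_of_pos_of_lt_pi hs0 (by linarith [Real.pi_pos])
  have hk : 0 < Real.cos s := Real.cos_pos_of_mem_Ioo ⟨by linarith, hs1⟩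
  have e1 : Real.arccos (-1 / (1 / Real.sin s)) = π / 2 + s := by
    have : -1 / (1 / Real.sin s) = - Real.sin s := by field_simp
    rw [this, Real.arccos, Real.arcsin_neg, Real.arcsin_sin (by linarith) hs1.le]
    ring
  have e2 : Real.sqrt ((1 / Real.sin s) ^ 2 - 1) = Real.cos s / Real.sin s := by
    rw [Real.sqrt_eq_iff_mul_self_eq_of_pos (by positivity)]
    field_simp
    linarith [Real.sin_sq_add_cos_sq s]
  have hd : c - Real.sin s ≠ 0 := by linarith
  have e3 : (1 / Real.sin s - c) * (Real.cos s / Real.sin s) /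
          ((1 / Real.sin s) * ((1 / Real.sin s) * c - 1)) =
      (1 - c * Real.sin s) * Real.cos s / (c - Real.sin s) := by
    have h : (1 / Real.sin s) * ((1 / Real.sin s) * c - 1)
        = (c - Real.sin s) / Real.sin s ^ 2 := by field_simp
    rw [h]
    field_simp
  rw [e1, e2, e3]
  constructor <;> intro h <;> linarith

theorem aux_deriv (c s : ℝ) (hc : Real.sin s < c) :
    HasDerivAt (fun s => (1 - c * Real.sin s) * Real.cos s / (c - Real.sin s) - s)
      (Real.cos s ^ 2 * (1 - 2 * c ^ 2 + c * Real.sin s) / (c - Real.sin s) ^ 2) s := by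
  have hd : c - Real.sin s ≠ 0 := by linarith
  have hS := Real.hasDerivAt_sin s
  have hC := Real.hasDerivAt_cos s
  have := ((((hS.const_mul c).const_sub 1).mul hC).div (hS.const_sub c) hd).sub (hasDerivAt_id s)
  refine this.congr_deriv ?_
  simp only [Pi.mul_apply]
  rw [div_sub_one (pow_ne_zero 2 hd)]
  congr 1
  have h : Real.cos s ^ 2 = 1 - Real.sin s ^ 2 := by linarith [Real.sin_sq_add_cos_sq s]
  linear_combination (-c * (c - Real.sin s) + 1 - c * Real.sin s - (1 - 2 * c ^ 2 + c * Real.sin s)) * h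

theorem aux_uniq (c a b : ℝ) (h1 : 2 / π < c) (ha : 0 < a) (hab : a < b) (hb : b < π / 2)
    (hbc : Real.sin b < c)
    (ea : (1 - c * Real.sin a) * Real.cos a / (c - Real.sin a) - a = π / 2)
    (eb : (1 - c * Real.sin b) * Real.cos b / (c - Real.sin b) - b = π / 2) : False := by
  have hpi := Real.pi_pos
  have hc0 : 0 < c := lt_trans (by positivity) h1
  have hs : ∀ s, 0 ≤ s → s ≤ b → Real.sin s < c := fun s h0 h =>
    lt_of_le_of_lt (Real.sin_le_sin_of_le_of_le_pi_div_two (by linarith) hb.le h) hbc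
  set G : ℝ → ℝ := fun s => (1 - c * Real.sin s) * Real.cos s / (c - Real.sin s) - s with hG
  set G' : ℝ → ℝ := fun s =>
    (Real.cos s ^ 2 * (1 - 2 * c ^ 2 + c * Real.sin s) / (c - Real.sin s) ^ 2) with hG'
  have hD : ∀ s, 0 ≤ s → s ≤ b → HasDerivAt G (G' s) s := fun s h0 h => aux_deriv c s (hs s h0 h)
  have g0 : G 0 < π / 2 := by
    simp only [hG, Real.sin_zero, Real.cos_zero]
    rw [div_lt_iff₀ hpi] at h1
    have : 1 / c < π / 2 := by rw [div_lt_iff₀ hc0]; linarith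
    simpa using this
  obtain ⟨x, hx, ex⟩ := exists_hasDerivAt_eq_slope G G' ha
    (fun s h => (hD s h.1 (by linarith [h.2])).continuousAt.continuousWithinAt)
    (fun s h => hD s h.1.le (by linarith [h.2]))
  obtain ⟨y, hy, ey⟩ := exists_hasDerivAt_eq_slope G G' hab
    (fun s h => (hD s (by linarith [h.1]) h.2).continuousAt.continuousWithinAt)
    (fun s h => hD s (by linarith [h.1]) h.2.le)
  have ea' : G a = π / 2 := ea
  have eb' : G b = π / 2 := eb
  have px : 0 < G' x := by
    rw [ex]; apply div_pos <;> linarith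
  have py : G' y = 0 := by rw [ey, ea', eb']; simp
  have hxy : Real.sin x < Real.sin y :=
    Real.sin_lt_sin_of_lt_of_le_pi_div_two (by linarith [hx.1]) (by linarith [hy.2])
      (by linarith [hx.2, hy.1])
  have hky : 0 < Real.cos y :=
    Real.cos_pos_of_mem_Ioo ⟨by linarith [hy.1], by linarith [hy.2]⟩
  have hdy : 0 < c - Real.sin y := by linarith [hs y (by linarith [hy.1]) hy.2.le]
  have zx : 0 < 1 - 2 * c ^ 2 + c * Real.sin x := by
    by_contra hn
    push Not at hn
    have : G' x ≤ 0 := div_nonpos_of_nonpos_of_nonneg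
      (mul_nonpos_of_nonneg_of_nonpos (sq_nonneg _) hn) (sq_nonneg _)
    linarith
  have zy : 0 < 1 - 2 * c ^ 2 + c * Real.sin y := by nlinarith
  have : 0 < G' y := by simp only [hG']; positivity
  linarith

theorem aux_exists (c : ℝ) (h1 : 2 / π < c) (h2 : c < 1) :
    ∃ s, 0 < s ∧ s < π / 2 ∧ Real.sin s < c ∧
      (1 - c * Real.sin s) * Real.cos s / (c - Real.sin s) - s = π / 2 := by
  have hpi := Real.pi_pos
  have hc0 : 0 < c := lt_trans (by positivity) h1
  rw [div_lt_iff₀ hpi] at h1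
  have hA : 0 < Real.arcsin c := Real.arcsin_pos.2 hc0
  have hA2 : Real.arcsin c < π / 2 := Real.arcsin_lt_pi_div_two.2 h2
  have hsA : Real.sin (Real.arcsin c) = c := Real.sin_arcsin (by linarith) h2.le
  have hkA : 0 < Real.cos (Real.arcsin c) :=
    Real.cos_pos_of_mem_Ioo ⟨by linarith, hA2⟩
  have hcont : ContinuousOn (fun s => (1 - c * Real.sin s) * Real.cos s
      - (s + π / 2) * (c - Real.sin s)) (Set.Icc 0 (Real.arcsin c)) := by fun_prop
  have hmem := intermediate_value_Ioo hA.le hcont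
  obtain ⟨s, hs, es⟩ := hmem (show (0:ℝ) ∈ _ from by
    constructor
    · simp; linarith
    · simp only [hsA]
      have : 0 < 1 - c * c := by nlinarith
      have := mul_pos this hkA
      linarith)
  have hsc : Real.sin s < c := by
    rw [← hsA]
    exact Real.sin_lt_sin_of_lt_of_le_pi_div_two (by linarith [hs.1]) hA2.le hs.2
  refine ⟨s, hs.1, by linarith [hs.2], hsc, ?_⟩
  have hd : c - Real.sin s ≠ 0 := by linarith
  have : (1 - c * Real.sin s) * Real.cos s / (c - Real.sin s) = s + π / 2 := by
    rw [div_eq_iff hd]; simp only at es; linarith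
  linarith

theorem aux_param (c b : ℝ) (hb : 1 < b) (hbc : 1 < b * c) :
    ∃ s, 0 < s ∧ s < π / 2 ∧ Real.sin s < c ∧ b = 1 / Real.sin s := by
  have hb0 : 0 < b := by linarith
  have h1 : 1 / b < 1 := by rw [div_lt_one hb0]; exact hb
  have h0 : 0 < 1 / b := by positivity
  have hs : Real.sin (Real.arcsin (1 / b)) = 1 / b := Real.sin_arcsin (by linarith) h1.le
  refine ⟨Real.arcsin (1 / b), Real.arcsin_pos.2 h0, Real.arcsin_lt_pi_div_two.2 h1, ?_, ?_⟩
  · rw [hs, div_lt_iff₀ hb0]; linarith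
  · rw [hs]; simp

theorem beta0_exists_unique (θ : ℝ) (h1 : 2 / π < Real.cos θ) (h2 : Real.cos θ < 1) :
    ∃! β₀ : ℝ, 1 < β₀ ∧ 1 < β₀ * Real.cos θ ∧
      Real.arccos (-1 / β₀)
        = (β₀ - Real.cos θ) * Real.sqrt (β₀ ^ 2 - 1) / (β₀ * (β₀ * Real.cos θ - 1)) := by
  generalize Real.cos θ = c at h1 h2 ⊢
  obtain ⟨s, s0, s1, sc, es⟩ := aux_exists c h1 h2
  have hx : 0 < Real.sin s := Real.sin_pos_of_pos_of_lt_pi s0 (by linarith [Real.pi_pos])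
  refine ⟨1 / Real.sin s, ⟨?_, ?_, (aux_iff c s s0 s1 sc).2 es⟩, ?_⟩
  · rw [lt_div_iff₀ hx]; linarith
  · rw [one_div_mul_eq_div, lt_div_iff₀ hx]; linarith
  · rintro b ⟨hb, hbc, hE⟩
    obtain ⟨t, t0, t1, tc, rfl⟩ := aux_param c b hb hbc
    have et := (aux_iff c t t0 t1 tc).1 hE
    rcases lt_trichotomy t s with h | h | h
    · exact (aux_uniq c t s h1 t0 h s1 sc et es).elim
    · rw [h]
    · exact (aux_uniq c s t h1 s0 h t1 tc es et).elim
end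

section
/- For every θ with 1/2 < cos θ < 2/π, there exists exactly one real number β₁ ∈ (1, ∞) such that arccos(1/β₁) = (β₁ + cos θ)·√(β₁² − 1) / (β₁·(β₁ cos θ + 1)). -/
open Real

lemma aux_deriv_s6 (k x : ℝ) (h : k + cos x ≠ 0) :
    HasDerivAt (fun x => sin x * (1 + k * cos x) / (k + cos x) - x)
      (-(sin x ^ 2 * (k * cos x + 2 * k ^ 2 - 1)) / (k + cos x) ^ 2) x := by
  have h1 := (((hasDerivAt_sin x).mul (((hasDerivAt_cos x).const_mul k).const_add 1)).div
    ((hasDerivAt_cos x).const_add k) h).sub (hasDerivAt_id x)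
  refine h1.congr_deriv ?_
  simp only [Pi.mul_apply]
  have e : sin x ^ 2 = 1 - cos x ^ 2 := by rw [sin_sq]
  field_simp
  ring_nf
  simp only [e]
  ring

lemma aux_core (k : ℝ) (h1 : 1 / 2 < k) (h2 : k < 2 / π) :
    ∃! x : ℝ, x ∈ Set.Ioo 0 (π / 2) ∧ sin x * (1 + k * cos x) / (k + cos x) - x = 0 := by
  have hpi := pi_gt_three
  have hk : k * π < 2 := by rwa [lt_div_iff₀ pi_pos] at h2
  have hk3 : k < 2 / 3 := by nlinarith
  have hk0 : 0 < k := by linarith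
  set g : ℝ → ℝ := fun x => sin x * (1 + k * cos x) / (k + cos x) - x with hg
  have hpos : ∀ x ∈ Set.Icc 0 (π / 2), 0 < k + cos x := by
    intro x hx
    have := cos_nonneg_of_mem_Icc (x := x) ⟨by linarith [hx.1], hx.2⟩
    linarith
  have hcont : ContinuousOn g (Set.Icc 0 (π / 2)) := fun x hx =>
    (aux_deriv_s6 k x (hpos x hx).ne').continuousAt.continuousWithinAt
  set m := (1 - 2 * k ^ 2) / k with hm
  have hm0 : 0 < m := div_pos (by nlinarith) hk0
  have hm1 : m < 1 := by rw [hm, div_lt_one hk0]; nlinarith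
  have hkm : k * m = 1 - 2 * k ^ 2 := by rw [hm]; field_simp
  set a := arccos m with ha
  have ha0 : 0 < a := arccos_pos.2 hm1
  have ha1 : a < π / 2 := arccos_lt_pi_div_two.2 hm0
  have hca : cos a = m := cos_arccos (by linarith) hm1.le
  have hanti : StrictAntiOn g (Set.Icc 0 a) := by
    apply strictAntiOn_of_deriv_neg (convex_Icc _ _)
      (hcont.mono (Set.Icc_subset_Icc le_rfl ha1.le))
    intro x hx
    rw [interior_Icc] at hx
    have hp := hpos x ⟨hx.1.le, by linarith [hx.2]⟩
    rw [(aux_deriv_s6 k x hp.ne').deriv, neg_div, neg_lt_zero]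
    have hs := sin_pos_of_pos_of_lt_pi hx.1 (by linarith [hx.2])
    have hc : cos a < cos x := cos_lt_cos_of_nonneg_of_le_pi hx.1.le (by linarith) hx.2
    have : 0 < k * cos x + 2 * k ^ 2 - 1 := by rw [hca] at hc; nlinarith
    positivity
  have hmono : StrictMonoOn g (Set.Icc a (π / 2)) := by
    apply strictMonoOn_of_deriv_pos (convex_Icc _ _)
      (hcont.mono (Set.Icc_subset_Icc ha0.le le_rfl))
    intro x hx
    rw [interior_Icc] at hx
    have hp := hpos x ⟨by linarith [hx.1], hx.2.le⟩
    rw [(aux_deriv_s6 k x hp.ne').deriv]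
    have hs := sin_pos_of_pos_of_lt_pi (x := x) (by linarith [hx.1]) (by linarith [hx.2])
    have hc : cos x < cos a := cos_lt_cos_of_nonneg_of_le_pi ha0.le (by linarith [hx.2]) hx.1
    have : 0 < -(k * cos x + 2 * k ^ 2 - 1) := by rw [hca] at hc; nlinarith
    rw [← mul_neg]
    positivity
  have g0 : g 0 = 0 := by simp [hg]
  have g1 : 0 < g (π / 2) := by
    simp only [hg, sin_pi_div_two, cos_pi_div_two]
    rw [sub_pos, lt_div_iff₀ (by linarith)]
    nlinarith
  have hneg : ∀ x, 0 < x → x ≤ a → g x < 0 := fun x hx hxa => by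
    rw [← g0]
    exact hanti ⟨le_rfl, ha0.le⟩ ⟨hx.le, hxa⟩ hx
  obtain ⟨x, hx, hgx⟩ := intermediate_value_Ioo ha1.le
    (hcont.mono (Set.Icc_subset_Icc ha0.le le_rfl)) ⟨hneg a ha0 le_rfl, g1⟩
  refine ⟨x, ⟨⟨by linarith [hx.1], hx.2⟩, hgx⟩, ?_⟩
  rintro y ⟨hy, hgy⟩
  change g y = 0 at hgy
  have hay : a < y := by
    by_contra! h
    linarith [hneg y hy.1 h]
  exact hmono.injOn ⟨hay.le, hy.2.le⟩ ⟨hx.1.le, hx.2.le⟩ (hgy.trans hgx.symm)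

lemma aux_eq (k b : ℝ) (hk : 0 < k) (hb : 1 < b) :
    (b + k) * √(b ^ 2 - 1) / (b * (b * k + 1)) =
      sin (arccos (1 / b)) * (1 + k * cos (arccos (1 / b))) / (k + cos (arccos (1 / b))) := by
  have hb0 : 0 < b := by linarith
  have h1 : 1 / b ≤ 1 := by rw [div_le_one hb0]; exact hb.le
  have h0 : 0 < 1 / b := by positivity
  have e : 1 - (1 / b) ^ 2 = (b ^ 2 - 1) / b ^ 2 := by field_simp
  rw [sin_arccos, cos_arccos (by linarith) h1, e, sqrt_div' _ (by positivity), sqrt_sq hb0.le]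
  have : b * k + 1 ≠ 0 := by positivity
  have : k + 1 / b ≠ 0 := by positivity
  field_simp

theorem beta1_exists_unique (θ : ℝ) (h1 : 1 / 2 < Real.cos θ) (h2 : Real.cos θ < 2 / π) :
    ∃! β₁ : ℝ, 1 < β₁ ∧
      Real.arccos (1 / β₁)
        = (β₁ + Real.cos θ) * Real.sqrt (β₁ ^ 2 - 1) / (β₁ * (β₁ * Real.cos θ + 1)) := by
  have hk : 0 < cos θ := by linarith
  obtain ⟨x, ⟨hx, hgx⟩, hu⟩ := aux_core (cos θ) h1 h2
  have hc0 : 0 < cos x := cos_pos_of_mem_Ioo ⟨by linarith [hx.1, pi_pos], hx.2⟩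
  have hc1 : cos x < 1 := by
    rw [← cos_zero]
    exact cos_lt_cos_of_nonneg_of_le_pi le_rfl (by linarith [hx.2, pi_pos]) hx.1
  have hb : 1 < 1 / cos x := by rwa [lt_div_iff₀ hc0, one_mul]
  refine ⟨1 / cos x, ⟨hb, ?_⟩, ?_⟩
  · rw [aux_eq _ _ hk hb, one_div_one_div, arccos_cos hx.1.le (by linarith [hx.2, pi_pos])]
    linarith
  · rintro b ⟨hb1, hbe⟩
    have hb0 : 0 < b := by linarith
    have h1' : 1 / b < 1 := by rw [div_lt_one hb0]; exact hb1
    have h0' : 0 < 1 / b := by positivity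
    rw [aux_eq _ _ hk hb1] at hbe
    have := hu (arccos (1 / b))
      ⟨⟨arccos_pos.2 h1', arccos_lt_pi_div_two.2 h0'⟩, by linarith⟩
    rw [← this, cos_arccos (by linarith) h1'.le, one_div_one_div]
end

section
/- Let a, b, c ∈ ℝ with a < 0, c < 0 and D := b² − 4ac < 0. Then ∫₀^∞ ∫₀^∞ exp(a·x² + b·x·y + c·y²) dx dy = (π + 2·arctan(b/√(−D))) / (2·√(−D)). -/
open Real MeasureTheory

lemma aux_inner (q : ℝ) (hq : 0 < q) :
    ∫⁻ x in Set.Ioi (0:ℝ), ENNReal.ofReal (x * Real.exp (-q * x ^ 2))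
      = ENNReal.ofReal (1 / (2 * q)) := by
  have hd : ∀ x ∈ Set.Ici (0:ℝ), HasDerivAt (fun x : ℝ => -(1 / (2 * q)) * Real.exp (-q * x ^ 2))
      (x * Real.exp (-q * x ^ 2)) x := by
    intro x _
    have h := ((((hasDerivAt_id x).pow 2).const_mul (-q)).exp).const_mul (-(1 / (2 * q)))
    refine HasDerivAt.congr_deriv h ?_
    simp
    field_simp
  have hp : ∀ x ∈ Set.Ioi (0:ℝ), 0 ≤ x * Real.exp (-q * x ^ 2) := fun x hx =>
    mul_nonneg (le_of_lt hx) (Real.exp_pos _).le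
  have ht : Filter.Tendsto (fun x : ℝ => -(1 / (2 * q)) * Real.exp (-q * x ^ 2)) Filter.atTop
      (nhds (-(1 / (2 * q)) * 0)) := by
    refine Filter.Tendsto.const_mul _ (Real.tendsto_exp_atBot.comp ?_)
    exact (Filter.tendsto_pow_atTop (by norm_num)).const_mul_atTop_of_neg (by linarith)
  have hi := integrableOn_Ioi_deriv_of_nonneg' hd hp ht
  rw [← ofReal_integral_eq_lintegral_ofReal hi
    ((ae_restrict_iff' measurableSet_Ioi).2 (Filter.Eventually.of_forall hp)),
    integral_Ioi_of_hasDerivAt_of_nonneg' hd hp ht]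
  simp

lemma aux_outer (a b c : ℝ) (hc : c < 0) (hD : b ^ 2 - 4 * a * c < 0)
    (hq : ∀ t : ℝ, 0 < -(a + b * t + c * t ^ 2)) :
    ∫⁻ t in Set.Ioi (0:ℝ), ENNReal.ofReal (1 / (2 * (-(a + b * t + c * t ^ 2))))
      = ENNReal.ofReal ((π + 2 * Real.arctan (b / Real.sqrt (-(b ^ 2 - 4 * a * c))))
          / (2 * Real.sqrt (-(b ^ 2 - 4 * a * c)))) := by
  have hs2 := Real.sq_sqrt (show 0 ≤ -(b ^ 2 - 4 * a * c) by linarith)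
  have hs : 0 < Real.sqrt (-(b ^ 2 - 4 * a * c)) := Real.sqrt_pos.2 (by linarith)
  set s := Real.sqrt (-(b ^ 2 - 4 * a * c)) with hsdef
  have hd : ∀ t ∈ Set.Ici (0:ℝ), HasDerivAt
      (fun t : ℝ => (1 / s) * Real.arctan (((-2 * c) * t + -b) / s))
      (1 / (2 * (-(a + b * t + c * t ^ 2)))) t := by
    intro t _
    have h := (((((hasDerivAt_id t).const_mul (-2 * c)).add_const (-b)).div_const s).arctan).const_mul
      (1 / s)
    refine HasDerivAt.congr_deriv h ?_
    have h1 := hq t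
    simp only [id]
    have e : 1 + ((-2 * c * t + -b) / s) ^ 2 = (-4 * c) * (-(a + b * t + c * t ^ 2)) / s ^ 2 := by
      field_simp
      rw [hs2]; ring
    rw [e]
    have hc' : c ≠ 0 := hc.ne
    generalize -(a + b * t + c * t ^ 2) = Q at *
    have := h1.ne'
    field_simp
    try norm_num
  have hp : ∀ t ∈ Set.Ioi (0:ℝ), 0 ≤ 1 / (2 * (-(a + b * t + c * t ^ 2))) := fun t _ => by
    have := hq t
    positivity
  have ht : Filter.Tendsto (fun t : ℝ => (1 / s) * Real.arctan (((-2 * c) * t + -b) / s))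
      Filter.atTop (nhds ((1 / s) * (π / 2))) := by
    refine Filter.Tendsto.const_mul _
      ((Real.tendsto_arctan_atTop.mono_right nhdsWithin_le_nhds).comp ?_)
    refine Filter.Tendsto.atTop_div_const hs ?_
    exact Filter.tendsto_atTop_add_const_right _ _
      (Filter.tendsto_id.const_mul_atTop (by linarith))
  have hi := integrableOn_Ioi_deriv_of_nonneg' hd hp ht
  rw [← ofReal_integral_eq_lintegral_ofReal hi
    ((ae_restrict_iff' measurableSet_Ioi).2 (Filter.Eventually.of_forall hp)),
    integral_Ioi_of_hasDerivAt_of_nonneg' hd hp ht]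
  congr 1
  rw [mul_zero, zero_add, neg_div, Real.arctan_neg]
  field_simp
  try ring

lemma aux_subst (f : ℝ → ENNReal) (x : ℝ) (hx : 0 < x) :
    ∫⁻ y in Set.Ioi (0:ℝ), f y = ∫⁻ t in Set.Ioi (0:ℝ), ENNReal.ofReal x * f (x * t) := by
  have h := lintegral_image_eq_lintegral_abs_deriv_mul (s := Set.Ioi (0:ℝ))
    (f := fun t => x * t) (f' := fun _ => x) measurableSet_Ioi
    (fun t _ => by simpa using ((hasDerivAt_id t).const_mul x).hasDerivWithinAt)
    (fun u _ v _ huv => mul_left_cancel₀ hx.ne' huv) f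
  rw [abs_of_pos hx] at h
  rw [← h]
  congr 2
  ext y
  simp only [Set.mem_image, Set.mem_Ioi]
  constructor
  · intro hy
    exact ⟨y / x, by positivity, by field_simp⟩
  · rintro ⟨t, ht, rfl⟩
    positivity

theorem integral_exp_quadratic_form_positive_quadrant
    (a b c : ℝ) (ha : a < 0) (hc : c < 0) (hD : b ^ 2 - 4 * a * c < 0) :
    ∫ p in (Set.Ioi (0 : ℝ)) ×ˢ (Set.Ioi (0 : ℝ)),
        Real.exp (a * p.1 ^ 2 + b * p.1 * p.2 + c * p.2 ^ 2)
      = (π + 2 * Real.arctan (b / Real.sqrt (-(b ^ 2 - 4 * a * c))))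
          / (2 * Real.sqrt (-(b ^ 2 - 4 * a * c))) := by
  have hq : ∀ t : ℝ, 0 < -(a + b * t + c * t ^ 2) := by
    intro t
    have h : 0 < (-4 * c) * (-(a + b * t + c * t ^ 2)) := by
      nlinarith [sq_nonneg (2 * c * t + b)]
    exact (pos_iff_pos_of_mul_pos h).1 (by linarith)
  rw [integral_eq_lintegral_of_nonneg_ae
    (Filter.Eventually.of_forall fun p => (Real.exp_pos _).le)
    (by apply Continuous.aestronglyMeasurable; fun_prop)]
  rw [Measure.volume_eq_prod, ← Measure.prod_restrict,
    lintegral_prod _ (by apply Measurable.aemeasurable; fun_prop)]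
  have h1 : ∫⁻ x in Set.Ioi (0:ℝ), ∫⁻ y in Set.Ioi (0:ℝ),
        ENNReal.ofReal (Real.exp (a * x ^ 2 + b * x * y + c * y ^ 2))
      = ∫⁻ x in Set.Ioi (0:ℝ), ∫⁻ t in Set.Ioi (0:ℝ),
        ENNReal.ofReal (x * Real.exp (-(-(a + b * t + c * t ^ 2)) * x ^ 2)) := by
    refine setLIntegral_congr_fun measurableSet_Ioi fun x hx => ?_
    have hx' : 0 < x := hx
    rw [aux_subst _ x hx']
    refine lintegral_congr fun t => ?_
    rw [← ENNReal.ofReal_mul hx'.le]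
    congr 3
    ring
  simp only
  rw [h1, lintegral_lintegral_swap (by apply Measurable.aemeasurable; unfold Function.uncurry; fun_prop)]
  simp_rw [fun t => aux_inner _ (hq t)]
  rw [aux_outer a b c hc hD hq, ENNReal.toReal_ofReal]
  have := Real.neg_pi_div_two_lt_arctan (b / Real.sqrt (-(b ^ 2 - 4 * a * c)))
  apply div_nonneg
  · linarith
  · positivity
end

section
/- Let X̂, Ŷ be independent half-normal random variables, and let λ = (λ₁, λ₂, λ₃) ∈ ℝ³ with λ₂ < 1/2, λ₃ < 1/2 and D := λ₁² − (1 − 2λ₂)(1 − 2λ₃) < 0. Then E[exp(λ₁·X̂·Ŷ + λ₂·X̂² + λ₃·Ŷ²)] = (π + 2·arctan(λ₁/√(−D))) / (π·√(−D)); in particular this expectation is finite, so the logarithmic moment generating function Λ(λ) = ln E[exp(λ₁ X̂Ŷ + λ₂ X̂² + λ₃ Ŷ²)] equals ln(π + 2·arctan(λ₁/√(−D))) − ln π − (1/2)·ln(−D) on this domain. -/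
open MeasureTheory Real ProbabilityTheory

lemma hn_lint {f : ℝ → ENNReal} (hf : Measurable f) :
    ∫⁻ x, f x ∂((gaussianReal 0 1).map (fun t => |t|))
      = ∫⁻ x in Set.Ioi (0:ℝ), ENNReal.ofReal (2 * (√(2 * π))⁻¹ * exp (-x ^ 2 / 2)) * f x := by
  rw [lintegral_map hf (by fun_prop), gaussianReal_of_var_ne_zero 0 one_ne_zero,
    lintegral_withDensity_eq_lintegral_mul _ (measurable_gaussianPDF 0 1) (by fun_prop),
    ← lintegral_add_compl _ (measurableSet_Ioi (a := (0:ℝ))), Set.compl_Ioi,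
    ← restrict_Iio_eq_restrict_Iic]
  have himg : Set.Iio (0:ℝ) = (fun x => -x) '' Set.Ioi (0:ℝ) := by simp
  rw [himg, lintegral_image_eq_lintegral_abs_deriv_mul (f' := fun _ => -1) measurableSet_Ioi
    (fun x _ => (hasDerivAt_neg x).hasDerivWithinAt) (neg_injective.injOn),
    ← lintegral_add_left (by have := measurable_gaussianPDF 0 1; fun_prop)]
  refine setLIntegral_congr_fun measurableSet_Ioi (fun x hx => ?_)
  have hx' : 0 < x := hx
  simp only [Pi.mul_apply, gaussianPDF, gaussianPDFReal, Function.comp, abs_neg, abs_one,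
    abs_of_pos hx', ENNReal.ofReal_one, one_mul, NNReal.coe_one, mul_one, sub_zero, neg_sq]
  rw [← add_mul, ← ENNReal.ofReal_add (by positivity) (by positivity)]
  congr 2
  ring

lemma lint_scale (g : ℝ → ENNReal) {x : ℝ} (hx : 0 < x) :
    ∫⁻ y in Set.Ioi (0:ℝ), g y = ∫⁻ t in Set.Ioi (0:ℝ), ENNReal.ofReal x * g (x * t) := by
  have himg : Set.Ioi (0:ℝ) = (fun t => x * t) '' Set.Ioi (0:ℝ) :=
    (Set.image_const_mul_Ioi_zero hx).symm
  conv_lhs => rw [himg]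
  rw [lintegral_image_eq_lintegral_abs_deriv_mul (f' := fun _ => x) measurableSet_Ioi
    (fun t _ => by simpa using ((hasDerivAt_id t).const_mul x).hasDerivWithinAt)
    ((mul_right_injective₀ hx.ne').injOn), abs_of_pos hx]

lemma lint_ftc {g g' : ℝ → ℝ} {l : ℝ} (hd : ∀ x, HasDerivAt g (g' x) x)
    (hp : ∀ x ∈ Set.Ioi (0:ℝ), 0 ≤ g' x) (hl : Filter.Tendsto g Filter.atTop (nhds l)) :
    ∫⁻ x in Set.Ioi (0:ℝ), ENNReal.ofReal (g' x) = ENNReal.ofReal (l - g 0) := by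
  rw [← integral_Ioi_of_hasDerivAt_of_nonneg' (fun x _ => hd x) hp hl]
  rw [ofReal_integral_eq_lintegral_ofReal
    (integrableOn_Ioi_deriv_of_nonneg' (fun x _ => hd x) hp hl)]
  exact (ae_restrict_iff' measurableSet_Ioi).2 (Filter.Eventually.of_forall hp)

lemma lint_inner {q : ℝ} (hq : 0 < q) :
    ∫⁻ x in Set.Ioi (0:ℝ), ENNReal.ofReal (2 / π * (x * exp (-(q / 2) * x ^ 2)))
      = ENNReal.ofReal (2 / π * (1 / q)) := by
  have hd : ∀ x : ℝ, HasDerivAt (fun x => -(2 / π * (1 / q)) * exp (-(q / 2) * x ^ 2))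
      (2 / π * (x * exp (-(q / 2) * x ^ 2))) x := by
    intro x
    refine ((((hasDerivAt_pow 2 x).const_mul (-(q / 2))).exp).const_mul
      (-(2 / π * (1 / q)))).congr_deriv ?_
    field_simp
    norm_num
  have hl : Filter.Tendsto (fun x : ℝ => -(2 / π * (1 / q)) * exp (-(q / 2) * x ^ 2))
      Filter.atTop (nhds (-(2 / π * (1 / q)) * 0)) := by
    refine Filter.Tendsto.const_mul _ (tendsto_exp_atBot.comp ?_)
    exact (Filter.tendsto_pow_atTop two_ne_zero).const_mul_atTop_of_neg (by linarith)
  rw [lint_ftc hd (fun x hx => ?_) hl]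
  · simp
  · have : 0 < x := hx
    positivity

lemma lint_outer {a b l s : ℝ} (hb : 0 < b) (hs : 0 < s) (h : s ^ 2 = a * b - l ^ 2) :
    ∫⁻ t in Set.Ioi (0:ℝ), ENNReal.ofReal (2 / π * (1 / (a - 2 * l * t + b * t ^ 2)))
      = ENNReal.ofReal ((π + 2 * arctan (l / s)) / (π * s)) := by
  have hQ : ∀ t : ℝ, b * (a - 2 * l * t + b * t ^ 2) = s ^ 2 + (b * t - l) ^ 2 := by
    intro t; rw [h]; ring
  have hQp : ∀ t : ℝ, 0 < a - 2 * l * t + b * t ^ 2 := by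
    intro t
    have : 0 < b * (a - 2 * l * t + b * t ^ 2) := by rw [hQ]; positivity
    exact pos_of_mul_pos_right this hb.le
  have hd : ∀ t : ℝ, HasDerivAt (fun t => 2 / (π * s) * arctan ((b * t - l) / s))
      (2 / π * (1 / (a - 2 * l * t + b * t ^ 2))) t := by
    intro t
    have h1 : HasDerivAt (fun t => (b * t - l) / s) (b / s) t := by
      simpa using (((hasDerivAt_id t).const_mul b).sub_const l).div_const s
    refine ((h1.arctan).const_mul (2 / (π * s))).congr_deriv ?_
    have e : 1 + ((b * t - l) / s) ^ 2 = b * (a - 2 * l * t + b * t ^ 2) / s ^ 2 := by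
      rw [hQ]; field_simp
    rw [e]
    have := (hQp t).ne'
    field_simp
  have hl : Filter.Tendsto (fun t => 2 / (π * s) * arctan ((b * t - l) / s))
      Filter.atTop (nhds (2 / (π * s) * (π / 2))) := by
    refine Filter.Tendsto.const_mul _
      ((tendsto_nhds_of_tendsto_nhdsWithin tendsto_arctan_atTop).comp ?_)
    exact (Filter.tendsto_atTop_add_const_right _ (-l)
      (Filter.tendsto_id.const_mul_atTop hb)).atTop_div_const hs
  rw [lint_ftc hd (fun t _ => by have := hQp t; positivity) hl]
  congr 1
  have : (b * 0 - l) / s = -(l / s) := by ring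
  rw [this, arctan_neg]
  field_simp
  ring

theorem halfnormal_lmgf {Ω : Type*} [MeasureSpace Ω]
    (hP : IsProbabilityMeasure (ℙ : Measure Ω))
    (X Y : Ω → ℝ) (hX : Measurable X) (hY : Measurable Y)
    (hIndep : IndepFun X Y ℙ)
    (hXlaw : Measure.map X ℙ = (gaussianReal 0 1).map (fun t => |t|))
    (hYlaw : Measure.map Y ℙ = (gaussianReal 0 1).map (fun t => |t|))
    (l₁ l₂ l₃ : ℝ) (h₂ : l₂ < 1 / 2) (h₃ : l₃ < 1 / 2)
    (hD : l₁ ^ 2 - (1 - 2 * l₂) * (1 - 2 * l₃) < 0) :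
    (∫⁻ ω, ENNReal.ofReal
        (Real.exp (l₁ * X ω * Y ω + l₂ * X ω ^ 2 + l₃ * Y ω ^ 2)) ∂ℙ)
      = ENNReal.ofReal
          ((π + 2 * Real.arctan (l₁ / Real.sqrt (-(l₁ ^ 2 - (1 - 2 * l₂) * (1 - 2 * l₃)))))
            / (π * Real.sqrt (-(l₁ ^ 2 - (1 - 2 * l₂) * (1 - 2 * l₃))))) ∧
    Real.log (∫⁻ ω, ENNReal.ofReal
        (Real.exp (l₁ * X ω * Y ω + l₂ * X ω ^ 2 + l₃ * Y ω ^ 2)) ∂ℙ).toReal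
      = Real.log (π + 2 * Real.arctan (l₁ / Real.sqrt (-(l₁ ^ 2 - (1 - 2 * l₂) * (1 - 2 * l₃)))))
          - Real.log π
          - (1 / 2) * Real.log (-(l₁ ^ 2 - (1 - 2 * l₂) * (1 - 2 * l₃))) := by
  obtain ⟨s, hsdef⟩ : ∃ s, s = Real.sqrt (-(l₁ ^ 2 - (1 - 2 * l₂) * (1 - 2 * l₃))) := ⟨_, rfl⟩
  have hs : 0 < s := by rw [hsdef]; exact Real.sqrt_pos.2 (by linarith)
  have hs2 : s ^ 2 = (1 - 2 * l₂) * (1 - 2 * l₃) - l₁ ^ 2 := by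
    rw [hsdef, Real.sq_sqrt (by linarith)]; ring
  have hlog : Real.log (-(l₁ ^ 2 - (1 - 2 * l₂) * (1 - 2 * l₃))) = 2 * Real.log s := by
    rw [show -(l₁ ^ 2 - (1 - 2 * l₂) * (1 - 2 * l₃)) = s ^ 2 by rw [hs2]; ring, Real.log_pow]
    norm_num
  rw [hlog, ← hsdef]
  have hb : 0 < 1 - 2 * l₃ := by linarith
  have hQp : ∀ t : ℝ, 0 < (1 - 2 * l₂) - 2 * l₁ * t + (1 - 2 * l₃) * t ^ 2 := by
    intro t
    have : 0 < (1 - 2 * l₃) * ((1 - 2 * l₂) - 2 * l₁ * t + (1 - 2 * l₃) * t ^ 2) := by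
      have : (1 - 2 * l₃) * ((1 - 2 * l₂) - 2 * l₁ * t + (1 - 2 * l₃) * t ^ 2)
        = s ^ 2 + ((1 - 2 * l₃) * t - l₁) ^ 2 := by rw [hs2]; ring
      rw [this]; positivity
    exact pos_of_mul_pos_right this hb.le
  have key : (∫⁻ ω, ENNReal.ofReal
        (Real.exp (l₁ * X ω * Y ω + l₂ * X ω ^ 2 + l₃ * Y ω ^ 2)) ∂ℙ)
      = ENNReal.ofReal ((π + 2 * Real.arctan (l₁ / s)) / (π * s)) := by
    have hm : Measurable (fun p : ℝ × ℝ => ENNReal.ofReal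
        (Real.exp (l₁ * p.1 * p.2 + l₂ * p.1 ^ 2 + l₃ * p.2 ^ 2))) := by fun_prop
    have e1 := lintegral_map (μ := (ℙ : Measure Ω)) hm (hX.prodMk hY)
    have : SFinite ((gaussianReal 0 1).map (fun t : ℝ => |t|)) := inferInstance
    rw [hIndep.map_prod_eq_prod_map_map hX.aemeasurable hY.aemeasurable, hXlaw, hYlaw,
      lintegral_prod _ hm.aemeasurable] at e1
    rw [← e1, hn_lint (Measurable.lintegral_prod_right' hm), ← lint_outer hb hs hs2]
    trans ∫⁻ x in Set.Ioi (0:ℝ), ∫⁻ t in Set.Ioi (0:ℝ), ENNReal.ofReal (2 / π *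
      (x * exp (-(((1 - 2 * l₂) - 2 * l₁ * t + (1 - 2 * l₃) * t ^ 2) / 2) * x ^ 2)))
    · refine setLIntegral_congr_fun measurableSet_Ioi (fun x hx => ?_)
      have hx' : 0 < x := hx
      beta_reduce
      rw [hn_lint (by fun_prop), lint_scale _ hx', ← lintegral_const_mul _ (by fun_prop)]
      refine lintegral_congr (fun t => ?_)
      rw [← ENNReal.ofReal_mul (by positivity), ← ENNReal.ofReal_mul (by positivity),
        ← ENNReal.ofReal_mul (by positivity)]
      congr 1
      have hc : (√(2 * π))⁻¹ * (√(2 * π))⁻¹ = (2 * π)⁻¹ := by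
        rw [← mul_inv, Real.mul_self_sqrt (by positivity)]
      have he : exp (-(((1 - 2 * l₂) - 2 * l₁ * t + (1 - 2 * l₃) * t ^ 2) / 2) * x ^ 2)
        = exp (-x ^ 2 / 2) * (exp (-(x * t) ^ 2 / 2) *
          exp (l₁ * x * (x * t) + l₂ * x ^ 2 + l₃ * (x * t) ^ 2)) := by
        rw [← exp_add, ← exp_add]; congr 1; ring
      rw [he]
      have h2 : 2 / π = 4 * ((√(2 * π))⁻¹ * (√(2 * π))⁻¹) := by
        rw [hc]; field_simp; norm_num
      rw [h2]; ring
    · rw [lintegral_lintegral_swap (by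
        apply Measurable.aemeasurable; unfold Function.uncurry; fun_prop)]
      exact lintegral_congr (fun t => lint_inner (hQp t))
  have hpos : 0 < π + 2 * Real.arctan (l₁ / s) := by
    have := Real.neg_pi_div_two_lt_arctan (l₁ / s); linarith
  refine ⟨key, ?_⟩
  rw [key, ENNReal.toReal_ofReal (by positivity), Real.log_div hpos.ne' (by positivity),
    Real.log_mul pi_ne_zero hs.ne']
  ring
end

section
/- Let X̂, Ŷ be independent half-normal random variables, define Λ(λ) = ln E[exp(λ₁ X̂Ŷ + λ₂ X̂² + λ₃ Ŷ²)] ∈ (−∞, +∞]. Let x, y > 0, θ ∈ (0, π/2), and z = (x·y·cos θ, x², y²). Then sup over λ ∈ ℝ³ with λ₁ > 0 of { λ₁z₁ + λ₂z₂ + λ₃z₃ − Λ(λ) } equals x²/2 + y²/2 − 1 − ln(xy) + E(θ), where E(θ) = ln( π·β₀·(β₀ cos θ − 1) / (2·(β₀ − cos θ)²) ) if cos θ > 2/π, with β₀ ∈ (1, ∞) the unique solution of β₀ cos θ > 1 and arccos(−1/β₀) = (β₀ − cos θ)√(β₀² − 1)/(β₀(β₀ cos θ − 1)); and E(θ) =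 0 if cos θ ≤ 2/π. -/
open MeasureTheory Real ProbabilityTheory

noncomputable section

/-- The logarithmic moment generating function `Λ(λ) = ln E[exp(λ₁·X·Y + λ₂·X² + λ₃·Y²)]`,
with values in `(−∞, +∞]` (modelled as an `EReal`; the value is `+∞` exactly when the
expectation is infinite). -/
def lmgf {Ω : Type*} [MeasureSpace Ω] (X Y : Ω → ℝ) (l : ℝ × ℝ × ℝ) : EReal :=
  ENNReal.log (∫⁻ ω, ENNReal.ofReal
    (Real.exp (l.1 * X ω * Y ω + l.2.1 * X ω ^ 2 + l.2.2 * Y ω ^ 2)) ∂ℙ)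


def kk (t : ℝ) : ℝ := (sin t - t * cos t) / (t - sin t * cos t)
def gg (c t : ℝ) : ℝ := sin t / (t * (1 + c * cos t))

lemma den_pos {t : ℝ} (h1 : π / 2 ≤ t) : 0 < t - sin t * cos t := by
  have := Real.pi_gt_three
  nlinarith [sin_sq_add_cos_sq t, sq_nonneg (sin t - cos t)]

lemma kk_mono : StrictMonoOn kk (Set.Ico (π / 2) π) := by
  have hpi := Real.pi_gt_d2
  have hd : ∀ t, π / 2 ≤ t → HasDerivAt kk
      (((cos t - (1 * cos t + t * (-sin t))) * (t - sin t * cos t) -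
        (sin t - t * cos t) * (1 - (cos t * cos t + sin t * (-sin t)))) / (t - sin t * cos t) ^ 2) t := by
    intro t ht
    exact ((hasDerivAt_sin t).sub ((hasDerivAt_id t).mul (hasDerivAt_cos t))).div
      ((hasDerivAt_id t).sub ((hasDerivAt_sin t).mul (hasDerivAt_cos t))) (den_pos ht).ne'
  apply strictMonoOn_of_deriv_pos (convex_Ico _ _)
  · intro t ht
    exact (hd t ht.1).continuousAt.continuousWithinAt
  · intro t ht
    rw [interior_Ico] at ht
    rw [(hd t ht.1.le).deriv]
    have hs : 0 < sin t := sin_pos_of_pos_of_lt_pi (by linarith [ht.1]) ht.2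
    have hc : cos t < 0 := cos_neg_of_pi_div_two_lt_of_lt ht.1 (by linarith [ht.2])
    apply div_pos _ (pow_pos (den_pos ht.1.le) 2)
    have hsc := sin_sq_add_cos_sq t
    have key : 0 < t ^ 2 + t * (sin t * cos t) - 2 * sin t ^ 2 := by
      have h1 : cos t ≤ sin t * cos t := by nlinarith [sin_le_one t]
      have h2 : t * cos t ≤ t * (sin t * cos t) :=
        mul_le_mul_of_nonneg_left h1 (by linarith [ht.1])
      have h3 : (1.57:ℝ) < t := by linarith [ht.1]
      nlinarith [sq_nonneg (t + 4 * cos t)]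
    have : ((cos t - (1 * cos t + t * (-sin t))) * (t - sin t * cos t) -
        (sin t - t * cos t) * (1 - (cos t * cos t + sin t * (-sin t))))
        = sin t * (t ^ 2 + t * (sin t * cos t) - 2 * sin t ^ 2) := by
      have : cos t * cos t = 1 - sin t ^ 2 := by linarith
      rw [this]; ring
    rw [this]; positivity

lemma gden_pos {c t : ℝ} (hc0 : 0 < c) (hc1 : c < 1) (h1 : π / 2 ≤ t) : 0 < 1 + c * cos t := by
  nlinarith [neg_one_le_cos t]

lemma gg_deriv {c t : ℝ} (hc0 : 0 < c) (hc1 : c < 1) (h1 : π / 2 ≤ t) :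
    HasDerivAt (gg c) ((c - kk t) * ((t - sin t * cos t) / (t * (1 + c * cos t)) ^ 2)) t := by
  have hp := pi_pos
  have hg := gden_pos hc0 hc1 h1
  have ht : 0 < t := by linarith
  have hd := den_pos h1
  have := (hasDerivAt_sin t).div ((hasDerivAt_id t).mul
    (((hasDerivAt_cos t).const_mul c).const_add 1)) (mul_pos ht hg).ne'
  refine this.congr_deriv ?_
  unfold kk
  have hsc : sin t ^ 2 = 1 - cos t ^ 2 := by linarith [sin_sq_add_cos_sq t]
  simp only [id]
  rw [← mul_div_assoc, sub_mul, div_mul_cancel₀ _ hd.ne']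
  congr 1
  simp only [Pi.mul_apply, id]
  linear_combination (t*c) * hsc

lemma gg_anti {c t₀ : ℝ} (hc0 : 0 < c) (hc1 : c < 1) (h : t₀ ∈ Set.Ico (π / 2) π)
    (hk : c ≤ kk t₀) : AntitoneOn (gg c) (Set.Ico t₀ π) := by
  apply antitoneOn_of_deriv_nonpos (convex_Ico _ _)
  · intro t ht
    exact (gg_deriv hc0 hc1 (h.1.trans ht.1)).continuousAt.continuousWithinAt
  · intro t ht
    rw [interior_Ico] at ht
    exact (gg_deriv hc0 hc1 (h.1.trans ht.1.le)).differentiableAt.differentiableWithinAt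
  · intro t ht
    rw [interior_Ico] at ht
    rw [(gg_deriv hc0 hc1 (h.1.trans ht.1.le)).deriv]
    have := kk_mono h ⟨h.1.trans ht.1.le, ht.2⟩ ht.1
    apply mul_nonpos_of_nonpos_of_nonneg (by linarith)
    exact div_nonneg (den_pos (h.1.trans ht.1.le)).le (sq_nonneg _)

lemma gg_mono {c t₀ : ℝ} (hc0 : 0 < c) (hc1 : c < 1) (h : t₀ ∈ Set.Ico (π / 2) π)
    (hk : kk t₀ ≤ c) : MonotoneOn (gg c) (Set.Icc (π / 2) t₀) := by
  apply monotoneOn_of_deriv_nonneg (convex_Icc _ _)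
  · intro t ht
    exact (gg_deriv hc0 hc1 (ht.1)).continuousAt.continuousWithinAt
  · intro t ht
    rw [interior_Icc] at ht
    exact (gg_deriv hc0 hc1 (ht.1.le)).differentiableAt.differentiableWithinAt
  · intro t ht
    rw [interior_Icc] at ht
    rw [(gg_deriv hc0 hc1 (ht.1.le)).deriv]
    have := kk_mono ⟨ht.1.le, ht.2.trans h.2⟩ h ht.2
    apply mul_nonneg (by linarith)
    exact div_nonneg (den_pos (ht.1.le)).le (sq_nonneg _)

lemma gg_max {c t₀ : ℝ} (hc0 : 0 < c) (hc1 : c < 1) (h : t₀ ∈ Set.Ico (π / 2) π)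
    (hk : kk t₀ = c) {t : ℝ} (ht : t ∈ Set.Ico (π / 2) π) : gg c t ≤ gg c t₀ := by
  rcases le_total t t₀ with h1 | h1
  · exact gg_mono hc0 hc1 h hk.le ⟨ht.1, h1⟩ ⟨h.1, le_rfl⟩ h1
  · exact gg_anti hc0 hc1 h hk.ge ⟨le_rfl, h.2⟩ ⟨h1, ht.2⟩ h1

lemma gg_le {c : ℝ} (hc0 : 0 < c) (hc1 : c < 1) 
    (hk : c ≤ 2 / π) {t : ℝ} (ht : t ∈ Set.Ico (π / 2) π) : gg c t ≤ 2 / π := by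
  have hp := pi_pos
  have h2 : kk (π / 2) = 2 / π := by simp [kk]
  have h3 : gg c (π / 2) = 2 / π := by simp [gg]
  rw [← h3]
  have h : π / 2 ∈ Set.Ico (π / 2) π := ⟨le_rfl, by linarith⟩
  exact gg_anti hc0 hc1 h (by rw [h2]; exact hk) h ht ht.1

open scoped ENNReal

lemma halfnormal_lint (f : ℝ → ℝ≥0∞) (hf : Measurable f) :
    ∫⁻ t, f t ∂((gaussianReal 0 1).map (fun t => |t|)) =
      ∫⁻ t in Set.Ioi 0, f t * ENNReal.ofReal (√(2 / π) * rexp (-t ^ 2 / 2)) := by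
  have hg : ∀ t, gaussianPDF 0 1 t = ENNReal.ofReal ((√(2 * π))⁻¹ * rexp (-t ^ 2 / 2)) := by
    intro t; simp [gaussianPDF, gaussianPDFReal]
  rw [lintegral_map hf (by fun_prop), gaussianReal_of_var_ne_zero _ (by simp),
    lintegral_withDensity_eq_lintegral_mul _ (measurable_gaussianPDF _ _) (by fun_prop)]
  simp only [Pi.mul_apply]
  have hm : Measurable fun t => gaussianPDF 0 1 t * f |t| := by
    have := measurable_gaussianPDF 0 1
    fun_prop
  have hneg : ∫⁻ t in Set.Iic 0, gaussianPDF 0 1 t * f |t| = ∫⁻ t in Set.Ioi 0, gaussianPDF 0 1 t * f |t| := by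
    have h := (Measure.measurePreserving_neg (volume : Measure ℝ)).setLIntegral_comp_preimage
      (measurableSet_Iic (a := (0:ℝ))) hm
    rw [← h]
    have : (Neg.neg ⁻¹' Set.Iic (0:ℝ)) = Set.Ici 0 := by ext; simp
    rw [this, setLIntegral_congr Ioi_ae_eq_Ici.symm]
    apply lintegral_congr
    intro t
    rw [hg, hg]; simp
  rw [← lintegral_add_compl _ (measurableSet_Ioi (a := (0:ℝ))), Set.compl_Ioi, hneg, ← two_mul,
    ← lintegral_const_mul _ hm]
  apply setLIntegral_congr_fun measurableSet_Ioi
  intro t ht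
  have ht : (0:ℝ) < t := ht
  simp only [abs_of_pos ht, hg]
  rw [← mul_assoc, mul_comm]
  congr 1
  rw [show (2:ℝ≥0∞) = ENNReal.ofReal 2 by simp, ← ENNReal.ofReal_mul (by norm_num)]
  congr 1
  rw [← mul_assoc]
  congr 1
  have hp := pi_pos
  rw [← div_eq_mul_inv, div_eq_iff (by positivity), ← Real.sqrt_mul (by positivity)]
  rw [show 2 / π * (2 * π) = 2 ^ 2 by field_simp]
  simp

lemma inner_pos {q : ℝ} (hq : 0 < q) :
    ∫⁻ u in Set.Ioi (0:ℝ), ENNReal.ofReal (u * rexp (-(q * u ^ 2 / 2))) = ENNReal.ofReal (1 / q) := by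
  have hd : ∀ u ∈ Set.Ici (0:ℝ), HasDerivAt (fun u : ℝ => -(1 / q) * rexp (-(q * u ^ 2 / 2)))
      (u * rexp (-(q * u ^ 2 / 2))) u := by
    intro u _
    have := (((((hasDerivAt_pow 2 u).const_mul q).div_const 2).neg).exp).const_mul (-(1/q))
    refine this.congr_deriv ?_
    field_simp
    simp
    ring
  have hpos : ∀ u ∈ Set.Ioi (0:ℝ), 0 ≤ u * rexp (-(q * u ^ 2 / 2)) := by
    intro u hu
    exact mul_nonneg (le_of_lt hu) (exp_pos _).le
  have hl : Filter.Tendsto (fun u : ℝ => -(1 / q) * rexp (-(q * u ^ 2 / 2))) Filter.atTop (nhds 0) := by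
    have h1 : Filter.Tendsto (fun u : ℝ => q * u ^ 2 / 2) Filter.atTop Filter.atTop := 
      ((Filter.tendsto_pow_atTop two_ne_zero).const_mul_atTop hq).atTop_div_const two_pos
    simpa using (tendsto_exp_neg_atTop_nhds_zero.comp h1).const_mul (-(1/q))
  have hi := integrableOn_Ioi_deriv_of_nonneg' hd hpos hl
  have hv := integral_Ioi_of_hasDerivAt_of_nonneg' hd hpos hl
  rw [← ofReal_integral_eq_lintegral_ofReal hi ((ae_restrict_iff' measurableSet_Ioi).2 (Filter.Eventually.of_forall hpos)), hv]
  simp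

lemma inner_top {q : ℝ} (hq : q ≤ 0) :
    ∫⁻ u in Set.Ioi (0:ℝ), ENNReal.ofReal (u * rexp (-(q * u ^ 2 / 2))) = ⊤ := by
  rw [eq_top_iff]
  calc (⊤:ℝ≥0∞) = ∫⁻ u in Set.Ioi (1:ℝ), 1 := by simp
    _ ≤ ∫⁻ u in Set.Ioi (1:ℝ), ENNReal.ofReal (u * rexp (-(q * u ^ 2 / 2))) := by
      apply setLIntegral_mono' measurableSet_Ioi
      intro u hu
      have hu : (1:ℝ) < u := hu
      rw [← ENNReal.ofReal_one]
      apply ENNReal.ofReal_le_ofReal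
      have : 1 ≤ rexp (-(q * u ^ 2 / 2)) := by
        apply one_le_exp
        nlinarith [mul_nonneg (neg_nonneg.2 hq) (sq_nonneg u)]
      nlinarith
    _ ≤ _ := lintegral_mono_set (Set.Ioi_subset_Ioi zero_le_one)

lemma scale_lint (f : ℝ → ℝ≥0∞) {u : ℝ} (hu : 0 < u) :
    ∫⁻ v in Set.Ioi (0:ℝ), f v = ∫⁻ t in Set.Ioi (0:ℝ), ENNReal.ofReal u * f (u * t) := by
  have him : (fun t => u * t) '' Set.Ioi (0:ℝ) = Set.Ioi 0 := by
    rw [Set.image_mul_left_Ioi hu]; simp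
  have := lintegral_image_eq_lintegral_abs_deriv_mul (f := fun t => u * t) (f' := fun _ => u)
    (measurableSet_Ioi (a := (0:ℝ)))
    (fun t _ => by simpa using ((hasDerivAt_id t).const_mul u).hasDerivWithinAt)
    (fun a _ b _ h => by simpa [hu.ne'] using h) f
  rw [him, abs_of_pos hu] at this
  exact this

lemma mgf_eq {Ω : Type*} [MeasureSpace Ω]
    (hP : IsProbabilityMeasure (ℙ : Measure Ω))
    (X Y : Ω → ℝ) (hX : Measurable X) (hY : Measurable Y)
    (hIndep : IndepFun X Y ℙ)
    (hXlaw : Measure.map X ℙ = (gaussianReal 0 1).map (fun t => |t|))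
    (hYlaw : Measure.map Y ℙ = (gaussianReal 0 1).map (fun t => |t|)) (l a b : ℝ) :
    ∫⁻ ω, ENNReal.ofReal
      (Real.exp (l * X ω * Y ω + ((1 - a) / 2) * X ω ^ 2 + ((1 - b) / 2) * Y ω ^ 2)) ∂ℙ =
    ENNReal.ofReal (2 / π) * ∫⁻ t in Set.Ioi (0:ℝ), ∫⁻ u in Set.Ioi (0:ℝ),
      ENNReal.ofReal (u * rexp (-((a - 2 * l * t + b * t ^ 2) * u ^ 2 / 2))) := by
  have hpi := pi_pos
  have hmap := (indepFun_iff_map_prod_eq_prod_map_map hX.aemeasurable hY.aemeasurable).1 hIndep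
  set F : ℝ × ℝ → ℝ≥0∞ := fun p => ENNReal.ofReal
      (Real.exp (l * p.1 * p.2 + ((1 - a) / 2) * p.1 ^ 2 + ((1 - b) / 2) * p.2 ^ 2)) with hF
  have hFm : Measurable F := by fun_prop
  have h1 : ∫⁻ ω, ENNReal.ofReal
      (Real.exp (l * X ω * Y ω + ((1 - a) / 2) * X ω ^ 2 + ((1 - b) / 2) * Y ω ^ 2)) ∂ℙ 
      = ∫⁻ p, F p ∂(Measure.map (fun ω => (X ω, Y ω)) ℙ) := by
    rw [lintegral_map hFm (by fun_prop)]
  have : IsProbabilityMeasure ((gaussianReal 0 1).map (fun t => |t|)) :=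
    Measure.isProbabilityMeasure_map (by fun_prop)
  rw [h1, hmap, hXlaw, hYlaw, lintegral_prod _ hFm.aemeasurable, halfnormal_lint _ hFm.lintegral_prod_right']
  have h2 : ∀ u ∈ Set.Ioi (0:ℝ), (∫⁻ y, F (u, y) ∂((gaussianReal 0 1).map (fun t => |t|))) *
        ENNReal.ofReal (√(2 / π) * rexp (-u ^ 2 / 2)) =
      ENNReal.ofReal (2 / π) * ∫⁻ t in Set.Ioi (0:ℝ), 
      ENNReal.ofReal (u * rexp (-((a - 2 * l * t + b * t ^ 2) * u ^ 2 / 2))) := by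
    intro u hu
    have hu : 0 < u := hu
    rw [halfnormal_lint _ (by fun_prop), scale_lint _ hu, ← lintegral_mul_const _ (by fun_prop),
      ← lintegral_const_mul _ (by fun_prop)]
    apply lintegral_congr
    intro t
    simp only [hF]
    rw [← ENNReal.ofReal_mul (by positivity), ← ENNReal.ofReal_mul (by positivity),
      ← ENNReal.ofReal_mul (by positivity), ← ENNReal.ofReal_mul (by positivity)]
    congr 1
    have e : rexp (-((a - 2 * l * t + b * t ^ 2) * u ^ 2 / 2)) =
      rexp (l * u * (u * t) + (1 - a) / 2 * u ^ 2 + (1 - b) / 2 * (u * t) ^ 2) * rexp (-(u * t) ^ 2 / 2)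
        * rexp (-u ^ 2 / 2) := by
      rw [← Real.exp_add, ← Real.exp_add]; congr 1; ring
    have s : 2 / π = √(2 / π) * √(2 / π) := (Real.mul_self_sqrt (by positivity)).symm
    rw [e]
    conv_rhs => rw [s]
    ring
  rw [setLIntegral_congr_fun measurableSet_Ioi h2, lintegral_const_mul _ (Measurable.lintegral_prod_right' (f := fun p : ℝ × ℝ => ENNReal.ofReal (p.1 * rexp (-((a - 2 * l * p.2 + b * p.2 ^ 2) * p.1 ^ 2 / 2)))) (by fun_prop)),
    lintegral_lintegral_swap (by fun_prop)]

lemma outer_fin {l a b : ℝ} (ha : 0 < a) (hb : 0 < b) (hD : 0 < a * b - l ^ 2) :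
    ∫⁻ t in Set.Ioi (0:ℝ), ∫⁻ u in Set.Ioi (0:ℝ),
      ENNReal.ofReal (u * rexp (-((a - 2 * l * t + b * t ^ 2) * u ^ 2 / 2))) =
    ENNReal.ofReal ((π / 2 + arctan (l / √(a * b - l ^ 2))) / √(a * b - l ^ 2)) := by
  set D := a * b - l ^ 2 with hDd
  have hs : 0 < √D := Real.sqrt_pos.2 hD
  have hs2 : √D ^ 2 = D := Real.sq_sqrt hD.le
  have hq : ∀ t : ℝ, 0 < a - 2 * l * t + b * t ^ 2 := by
    intro t
    have : b * (a - 2 * l * t + b * t ^ 2) = D + (b * t - l) ^ 2 := by rw [hDd]; ring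
    have h2 : 0 < b * (a - 2 * l * t + b * t ^ 2) := by rw [this]; positivity
    exact (mul_pos_iff_of_pos_left hb).1 h2
  rw [lintegral_congr (fun t => inner_pos (hq t))]
  have hd : ∀ t ∈ Set.Ici (0:ℝ), HasDerivAt (fun t : ℝ => arctan ((b * t - l) / √D) / √D)
      (1 / (a - 2 * l * t + b * t ^ 2)) t := by
    intro t _
    have := ((((((hasDerivAt_id t).const_mul b).sub_const l).div_const (√D))).arctan).div_const (√D)
    refine this.congr_deriv ?_
    have hq' := hq t
    have e : 1 + ((b * t - l) / √D) ^ 2 = b * (a - 2 * l * t + b * t ^ 2) / D := by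
      rw [div_pow, hs2, eq_div_iff hD.ne', add_mul, div_mul_cancel₀ _ hD.ne', hDd]; ring
    simp only [id]
    rw [e]
    have : D = √D * √D := (Real.mul_self_sqrt hD.le).symm
    have hD0 := hD.ne'
    have hq0 := hq'.ne'
    rw [mul_one, one_div_div, div_mul_div_comm, div_div, div_eq_div_iff (by positivity) (by positivity)]
    linear_combination (b * (a - 2 * l * t + b * t ^ 2)) * this
  have hpos : ∀ u ∈ Set.Ioi (0:ℝ), 0 ≤ 1 / (a - 2 * l * u + b * u ^ 2) := by
    intro u hu
    exact (div_pos one_pos (hq u)).le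
  have hl : Filter.Tendsto (fun t : ℝ => arctan ((b * t - l) / √D) / √D) Filter.atTop (nhds (π / 2 / √D)) := by
    have h1 : Filter.Tendsto (fun t : ℝ => (b * t - l) / √D) Filter.atTop Filter.atTop := 
      (Filter.tendsto_atTop_add_const_right _ (-l) (Filter.tendsto_id.const_mul_atTop hb)).atTop_div_const hs
    exact ((tendsto_nhds_of_tendsto_nhdsWithin tendsto_arctan_atTop).comp h1).div_const _
  have hi := integrableOn_Ioi_deriv_of_nonneg' hd hpos hl
  have hv := integral_Ioi_of_hasDerivAt_of_nonneg' hd hpos hl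
  rw [← ofReal_integral_eq_lintegral_ofReal hi ((ae_restrict_iff' measurableSet_Ioi).2 (Filter.Eventually.of_forall hpos)), hv]
  congr 1
  rw [mul_zero, zero_sub, neg_div, arctan_neg]
  ring

lemma outer_top_neg {l a b : ℝ} {t₀ : ℝ} (ht : 0 < t₀) (h : a - 2 * l * t₀ + b * t₀ ^ 2 < 0) :
    ∫⁻ t in Set.Ioi (0:ℝ), ∫⁻ u in Set.Ioi (0:ℝ),
      ENNReal.ofReal (u * rexp (-((a - 2 * l * t + b * t ^ 2) * u ^ 2 / 2))) = ⊤ := by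
  have ho : IsOpen (Set.Ioi 0 ∩ {t : ℝ | a - 2 * l * t + b * t ^ 2 < 0}) :=
    isOpen_Ioi.inter (isOpen_lt (by fun_prop) continuous_const)
  have hpos := ho.measure_pos volume ⟨t₀, ht, h⟩
  rw [eq_top_iff]
  calc (⊤:ℝ≥0∞) = ∫⁻ t in (Set.Ioi 0 ∩ {t : ℝ | a - 2 * l * t + b * t ^ 2 < 0}), ⊤ := by
        rw [setLIntegral_const, ENNReal.top_mul hpos.ne']
    _ ≤ ∫⁻ t in (Set.Ioi 0 ∩ {t : ℝ | a - 2 * l * t + b * t ^ 2 < 0}), ∫⁻ u in Set.Ioi (0:ℝ),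
      ENNReal.ofReal (u * rexp (-((a - 2 * l * t + b * t ^ 2) * u ^ 2 / 2))) := by
        apply setLIntegral_mono' ho.measurableSet
        intro t ht
        rw [inner_top (le_of_lt ht.2)]
    _ ≤ _ := lintegral_mono_set Set.inter_subset_left

lemma outer_top_zero {l a b : ℝ} (hl : 0 < l) (hb : 0 < b) (h : a * b = l ^ 2) :
    ∫⁻ t in Set.Ioi (0:ℝ), ∫⁻ u in Set.Ioi (0:ℝ),
      ENNReal.ofReal (u * rexp (-((a - 2 * l * t + b * t ^ 2) * u ^ 2 / 2))) = ⊤ := by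
  apply ENNReal.eq_top_of_forall_nnreal_le
  intro r
  obtain ⟨ε, hε, hr⟩ : ∃ ε : ℝ, 0 < ε ∧ (r:ℝ) ≤ 1 / (b * ε) := by
    refine ⟨1 / (b * (r + 1)), by positivity, ?_⟩
    have : 1 / (b * (1 / (b * ((r:ℝ) + 1)))) = r + 1 := by field_simp
    rw [this]; linarith
  have hlb : 0 < l / b := by positivity
  calc (r:ℝ≥0∞) ≤ ENNReal.ofReal (1 / (b * ε)) := by
        rw [← ENNReal.ofReal_coe_nnreal]; exact ENNReal.ofReal_le_ofReal hr
    _ = ∫⁻ t in Set.Ioo (l / b) (l / b + ε), ENNReal.ofReal (1 / (b * ε ^ 2)) := by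
        rw [setLIntegral_const, Real.volume_Ioo, ← ENNReal.ofReal_mul (by positivity)]
        congr 1
        field_simp
        ring
    _ ≤ ∫⁻ t in Set.Ioo (l / b) (l / b + ε), ∫⁻ u in Set.Ioi (0:ℝ),
      ENNReal.ofReal (u * rexp (-((a - 2 * l * t + b * t ^ 2) * u ^ 2 / 2))) := by
        apply setLIntegral_mono' measurableSet_Ioo
        intro t ht
        have ht1 : 0 < t - l / b := by linarith [ht.1]
        have ht2 : t - l / b ≤ ε := by linarith [ht.2]
        have e : a - 2 * l * t + b * t ^ 2 = b * (t - l / b) ^ 2 := by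
          field_simp
          linear_combination h
        rw [inner_pos (by rw [e]; positivity)]
        apply ENNReal.ofReal_le_ofReal
        rw [e]
        gcongr
    _ ≤ _ := lintegral_mono_set (fun t ht => hlb.trans ht.1)

lemma lmgf_fin {Ω : Type*} [MeasureSpace Ω]
    (hP : IsProbabilityMeasure (ℙ : Measure Ω))
    (X Y : Ω → ℝ) (hX : Measurable X) (hY : Measurable Y)
    (hIndep : IndepFun X Y ℙ)
    (hXlaw : Measure.map X ℙ = (gaussianReal 0 1).map (fun t => |t|))
    (hYlaw : Measure.map Y ℙ = (gaussianReal 0 1).map (fun t => |t|))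
    {φ p q : ℝ} (hφ : φ ∈ Set.Ioo (π / 2) π) (hp : 0 < p) (hq : 0 < q) :
    lmgf X Y (-cos φ * (p * q), (1 - p ^ 2) / 2, (1 - q ^ 2) / 2) =
      ((Real.log (2 / π * (φ / (sin φ * (p * q)))) : ℝ) : EReal) := by
  have hpi := pi_pos
  have hφ0 : 0 < φ := by linarith [hφ.1]
  have hs : 0 < sin φ := sin_pos_of_pos_of_lt_pi hφ0 hφ.2
  have hDe : p ^ 2 * q ^ 2 - (-cos φ * (p * q)) ^ 2 = (sin φ * (p * q)) ^ 2 := by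
    linear_combination (-(p * q) ^ 2) * sin_sq_add_cos_sq φ
  have hD : 0 < p ^ 2 * q ^ 2 - (-cos φ * (p * q)) ^ 2 := by rw [hDe]; positivity
  have hpq : 0 < sin φ * (p * q) := by positivity
  have hat : arctan (-cos φ * (p * q) / (sin φ * (p * q))) = φ - π / 2 := by
    rw [mul_div_mul_right _ _ (by positivity)]
    have : -cos φ / sin φ = tan (φ - π / 2) := by
      rw [tan_eq_sin_div_cos, sin_sub_pi_div_two, cos_sub_pi_div_two]
    rw [this, arctan_tan (by linarith) (by linarith [hφ.2])]
  unfold lmgf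
  simp only
  rw [mgf_eq hP X Y hX hY hIndep hXlaw hYlaw, outer_fin (by positivity) (by positivity) hD, hDe,
    Real.sqrt_sq hpq.le, hat, ← ENNReal.ofReal_mul (by positivity), 
    ENNReal.log_ofReal_of_pos (by rw [add_sub_cancel]; positivity)]
  rw [add_sub_cancel]

lemma lmgf_cases {Ω : Type*} [MeasureSpace Ω]
    (hP : IsProbabilityMeasure (ℙ : Measure Ω))
    (X Y : Ω → ℝ) (hX : Measurable X) (hY : Measurable Y)
    (hIndep : IndepFun X Y ℙ)
    (hXlaw : Measure.map X ℙ = (gaussianReal 0 1).map (fun t => |t|))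
    (hYlaw : Measure.map Y ℙ = (gaussianReal 0 1).map (fun t => |t|))
    (l : ℝ × ℝ × ℝ) (hl : 0 < l.1) :
    lmgf X Y l = ⊤ ∨ ∃ φ ∈ Set.Ioo (π / 2) π, ∃ p q : ℝ, 0 < p ∧ 0 < q ∧
      l = (-cos φ * (p * q), (1 - p ^ 2) / 2, (1 - q ^ 2) / 2) := by
  obtain ⟨l1, l2, l3⟩ := l
  simp only at hl
  obtain ⟨a, rfl⟩ : ∃ a, l2 = (1 - a) / 2 := ⟨1 - 2 * l2, by ring⟩
  obtain ⟨b, rfl⟩ : ∃ b, l3 = (1 - b) / 2 := ⟨1 - 2 * l3, by ring⟩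
  have hpi := pi_pos
  have htop : (∫⁻ t in Set.Ioi (0:ℝ), ∫⁻ u in Set.Ioi (0:ℝ),
      ENNReal.ofReal (u * rexp (-((a - 2 * l1 * t + b * t ^ 2) * u ^ 2 / 2))) = ⊤) →
      lmgf X Y (l1, (1 - a) / 2, (1 - b) / 2) = ⊤ := by
    intro h
    unfold lmgf
    simp only
    rw [mgf_eq hP X Y hX hY hIndep hXlaw hYlaw, h, ENNReal.mul_top (by simp; positivity)]
    simp
  rcases le_or_gt a 0 with ha | ha
  · left; apply htop
    apply outer_top_neg (t₀ := l1 / (|b| + 1)) (by positivity)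
    have h0 : 0 < |b| + 1 := by positivity
    set t := l1 / (|b| + 1) with ht
    have htp : 0 < t := by positivity
    have h1 : t * (|b| + 1) = l1 := div_mul_cancel₀ _ h0.ne'
    have h2 : b * t ^ 2 ≤ |b| * t ^ 2 := mul_le_mul_of_nonneg_right (le_abs_self b) (sq_nonneg _)
    nlinarith [mul_pos htp hl, sq_pos_of_pos htp]
  rcases le_or_gt b 0 with hb | hb
  · left; apply htop
    apply outer_top_neg (t₀ := a / l1) (by positivity)
    have h1 : 2 * l1 * (a / l1) = 2 * a := by field_simp
    rw [h1]
    nlinarith [mul_nonneg (neg_nonneg.2 hb) (sq_nonneg (a / l1))]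
  rcases lt_trichotomy (a * b) (l1 ^ 2) with h | h | h
  · left; apply htop
    apply outer_top_neg (t₀ := l1 / b) (by positivity)
    have : a - 2 * l1 * (l1 / b) + b * (l1 / b) ^ 2 = (a * b - l1 ^ 2) / b := by field_simp; ring
    rw [this]
    exact div_neg_of_neg_of_pos (by linarith) hb
  · left; exact htop (outer_top_zero hl hb h)
  · right
    have hsa : 0 < √a := Real.sqrt_pos.2 ha
    have hsb : 0 < √b := Real.sqrt_pos.2 hb
    have hsab : 0 < √a * √b := by positivity
    have hr : l1 / (√a * √b) < 1 := by
      rw [div_lt_one hsab]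
      apply lt_of_pow_lt_pow_left₀ 2 hsab.le
      rw [mul_pow, Real.sq_sqrt ha.le, Real.sq_sqrt hb.le]; exact h
    have hr0 : 0 < l1 / (√a * √b) := by positivity
    refine ⟨arccos (-(l1 / (√a * √b))), ⟨?_, ?_⟩, √a, √b, hsa, hsb, ?_⟩
    · rw [← not_le, arccos_le_pi_div_two]; linarith
    · refine lt_of_le_of_ne (arccos_le_pi _) ?_
      rw [Ne, arccos_eq_pi]; linarith
    · rw [cos_arccos (by linarith) (by linarith), Real.sq_sqrt ha.le, Real.sq_sqrt hb.le, neg_neg,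
        div_mul_cancel₀ _ hsab.ne']

lemma V_eq {x y c φ p q : ℝ} (hx : 0 < x) (hy : 0 < y) (hc0 : 0 < c) (hc1 : c < 1)
    (hφ : φ ∈ Set.Ioo (π / 2) π) (hp : 0 < p) (hq : 0 < q) :
    -cos φ * (p * q) * (x * y * c) + (1 - p ^ 2) / 2 * x ^ 2 + (1 - q ^ 2) / 2 * y ^ 2
      - Real.log (2 / π * (φ / (sin φ * (p * q)))) =
    x ^ 2 / 2 + y ^ 2 / 2 - Real.log (x * y) + Real.log (π / 2 * gg c φ)
      + Real.log (p * q * (x * y) * (1 + c * cos φ))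
      - p * q * (x * y) * (1 + c * cos φ) - (p * x - q * y) ^ 2 / 2 := by
  have hpi := pi_pos
  have hφ0 : 0 < φ := by linarith [hφ.1]
  have hs : 0 < sin φ := sin_pos_of_pos_of_lt_pi hφ0 hφ.2
  have hg := gden_pos hc0 hc1 hφ.1.le
  have e : Real.log (2 / π * (φ / (sin φ * (p * q)))) =
      Real.log (x * y) - Real.log (π / 2 * gg c φ) - Real.log (p * q * (x * y) * (1 + c * cos φ)) := by
    have hgg : 0 < gg c φ := by unfold gg; positivity
    rw [← Real.log_div (by positivity) (by positivity), ← Real.log_div (by positivity) (by positivity)]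
    congr 1
    unfold gg
    field_simp
  rw [e]; ring

lemma core (Λ : ℝ × ℝ × ℝ → EReal)
    (htop : ∀ l : ℝ × ℝ × ℝ, 0 < l.1 → Λ l = ⊤ ∨ ∃ φ ∈ Set.Ioo (π / 2) π, ∃ p q : ℝ, 0 < p ∧ 0 < q ∧
      l = (-cos φ * (p * q), (1 - p ^ 2) / 2, (1 - q ^ 2) / 2))
    (hfin : ∀ φ ∈ Set.Ioo (π / 2) π, ∀ p q : ℝ, 0 < p → 0 < q →
      Λ (-cos φ * (p * q), (1 - p ^ 2) / 2, (1 - q ^ 2) / 2) =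
      ((Real.log (2 / π * (φ / (sin φ * (p * q)))) : ℝ) : EReal))
    {x y c : ℝ} (hx : 0 < x) (hy : 0 < y) (hc0 : 0 < c) (hc1 : c < 1) :
    (⨆ l : {l : ℝ × ℝ × ℝ // 0 < l.1},
          ((l.1.1 * (x * y * c) + l.1.2.1 * x ^ 2 + l.1.2.2 * y ^ 2 : ℝ) : EReal)
            - Λ l.1) =
    ⨆ φ : Set.Ioo (π / 2) π,
      ((x ^ 2 / 2 + y ^ 2 / 2 - 1 - Real.log (x * y) + Real.log (π / 2 * gg c φ) : ℝ) : EReal) := by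
  apply le_antisymm
  · apply iSup_le
    rintro ⟨l, hl⟩
    rcases htop l hl with h | ⟨φ, hφ, p, q, hp, hq, rfl⟩
    · simp [h]
    · refine le_trans ?_ (le_iSup _ ⟨φ, hφ⟩)
      simp only
      rw [hfin φ hφ p q hp hq, ← EReal.coe_sub, EReal.coe_le_coe_iff, V_eq hx hy hc0 hc1 hφ hp hq]
      have hg := gden_pos hc0 hc1 hφ.1.le
      have := Real.log_le_sub_one_of_pos (x := p * q * (x * y) * (1 + c * cos φ)) (by positivity)
      linarith [sq_nonneg (p * x - q * y)]
  · apply iSup_le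
    rintro ⟨φ, hφ⟩
    have hg := gden_pos hc0 hc1 hφ.1.le
    have hsg : 0 < √(1 + c * cos φ) := Real.sqrt_pos.2 hg
    have hsq : √(1 + c * cos φ) ^ 2 = (1 + c * cos φ) := Real.sq_sqrt hg.le
    set r := √(1 + c * cos φ) with hr
    have hp : 0 < 1 / (x * r) := by positivity
    have hq : 0 < 1 / (y * r) := by positivity
    have hcos : cos φ < 0 := cos_neg_of_pi_div_two_lt_of_lt hφ.1 (by linarith [hφ.2, pi_pos])
    have hl : 0 < -cos φ * (1 / (x * r) * (1 / (y * r))) :=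
      mul_pos (by linarith) (mul_pos hp hq)
    refine le_trans ?_ (le_iSup _ ⟨(-cos φ * (1 / (x * r) * (1 / (y * r))),
      (1 - (1 / (x * r)) ^ 2) / 2, (1 - (1 / (y * r)) ^ 2) / 2), hl⟩)
    simp only
    rw [hfin φ hφ _ _ hp hq, ← EReal.coe_sub, EReal.coe_le_coe_iff, V_eq hx hy hc0 hc1 hφ hp hq]
    have e1 : 1 / (x * r) * (1 / (y * r)) * (x * y) * (1 + c * cos φ) = 1 := by
      rw [← hsq]; field_simp
    have e2 : 1 / (x * r) * x - 1 / (y * r) * y = 0 := by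
      field_simp; ring
    rw [e1, e2, Real.log_one]
    linarith

theorem fenchel_legendre_positive_lambda {Ω : Type*} [MeasureSpace Ω]
    (hP : IsProbabilityMeasure (ℙ : Measure Ω))
    (X Y : Ω → ℝ) (hX : Measurable X) (hY : Measurable Y)
    (hIndep : IndepFun X Y ℙ)
    (hXlaw : Measure.map X ℙ = (gaussianReal 0 1).map (fun t => |t|))
    (hYlaw : Measure.map Y ℙ = (gaussianReal 0 1).map (fun t => |t|))
    (x y θ : ℝ) (hx : 0 < x) (hy : 0 < y) (hθ : θ ∈ Set.Ioo 0 (π / 2)) :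
    (2 / π < Real.cos θ → ∀ β₀ : ℝ, 1 < β₀ → 1 < β₀ * Real.cos θ →
      Real.arccos (-1 / β₀)
        = (β₀ - Real.cos θ) * Real.sqrt (β₀ ^ 2 - 1) / (β₀ * (β₀ * Real.cos θ - 1)) →
      (⨆ l : {l : ℝ × ℝ × ℝ // 0 < l.1},
          ((l.1.1 * (x * y * Real.cos θ) + l.1.2.1 * x ^ 2 + l.1.2.2 * y ^ 2 : ℝ) : EReal)
            - lmgf X Y l.1)
        = ((x ^ 2 / 2 + y ^ 2 / 2 - 1 - Real.log (x * y)
            + Real.log (π * β₀ * (β₀ * Real.cos θ - 1)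
                / (2 * (β₀ - Real.cos θ) ^ 2)) : ℝ) : EReal)) ∧
    (Real.cos θ ≤ 2 / π →
      (⨆ l : {l : ℝ × ℝ × ℝ // 0 < l.1},
          ((l.1.1 * (x * y * Real.cos θ) + l.1.2.1 * x ^ 2 + l.1.2.2 * y ^ 2 : ℝ) : EReal)
            - lmgf X Y l.1)
        = ((x ^ 2 / 2 + y ^ 2 / 2 - 1 - Real.log (x * y) : ℝ) : EReal)) := by
  have hpi := pi_pos
  have hc0 : 0 < cos θ := cos_pos_of_mem_Ioo ⟨by linarith [hθ.1], hθ.2⟩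
  have hc1 : cos θ < 1 := by
    have := Real.cos_lt_cos_of_nonneg_of_le_pi (x := 0) (y := θ) le_rfl (by linarith [hθ.2]) hθ.1
    simpa using this
  rw [core (lmgf X Y) (lmgf_cases hP X Y hX hY hIndep hXlaw hYlaw)
    (fun φ hφ p q hp hq => lmgf_fin hP X Y hX hY hIndep hXlaw hYlaw hφ hp hq) hx hy hc0 hc1]
  set c := cos θ with hc
  have hgp : ∀ φ ∈ Set.Ioo (π / 2) π, 0 < π / 2 * gg c φ := by
    intro φ hφ
    have hφ0 : 0 < φ := by linarith [hφ.1]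
    have hs : 0 < sin φ := sin_pos_of_pos_of_lt_pi hφ0 hφ.2
    have hg := gden_pos hc0 hc1 hφ.1.le
    unfold gg; positivity
  refine ⟨?_, ?_⟩
  · intro _ β hβ1 hβc hβ
    have hβ0 : 0 < β := by linarith
    have hi1 : 1 / β < 1 := by rw [div_lt_one hβ0]; exact hβ1
    have hi0 : 0 < 1 / β := by positivity
    rw [neg_div] at hβ
    set φ := arccos (-(1 / β)) with hφd
    have hφ : φ ∈ Set.Ioo (π / 2) π := by
      constructor
      · rw [← not_le, hφd, arccos_le_pi_div_two]; linarith
      · refine lt_of_le_of_ne (arccos_le_pi _) ?_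
        rw [Ne, arccos_eq_pi]; linarith
    have hcos : cos φ = -(1 / β) := cos_arccos (by linarith) (by linarith)
    have hsin : sin φ = √(β ^ 2 - 1) / β := by
      rw [hφd, sin_arccos, show 1 - (-(1 / β)) ^ 2 = (β ^ 2 - 1) / β ^ 2 by field_simp,
        Real.sqrt_div' _ (sq_nonneg _), Real.sqrt_sq hβ0.le]
    have hb1 : 0 < β ^ 2 - 1 := by nlinarith
    have hr : 0 < √(β ^ 2 - 1) := Real.sqrt_pos.2 hb1
    have hr2 : √(β ^ 2 - 1) ^ 2 = β ^ 2 - 1 := Real.sq_sqrt hb1.le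
    set r := √(β ^ 2 - 1) with hrd
    have h1 : 0 < β * c - 1 := by linarith
    have h2 : 0 < β - c := by linarith
    have hk : kk φ = c := by
      unfold kk
      rw [div_eq_iff (den_pos hφ.1.le).ne', hcos, hsin]
      rw [hβ]
      field_simp
      ring
    have hG : π / 2 * gg c φ = π * β * (β * c - 1) / (2 * (β - c) ^ 2) := by
      unfold gg
      have e : 1 + c * cos φ = (β - c) / β := by rw [hcos]; field_simp; ring
      rw [e, hsin, hβ]
      field_simp
    rw [← hG]
    apply le_antisymm
    · apply iSup_le
      rintro ⟨t, ht⟩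
      rw [EReal.coe_le_coe_iff]
      have := gg_max hc0 hc1 ⟨hφ.1.le, hφ.2⟩ hk ⟨ht.1.le, ht.2⟩
      have := Real.log_le_log (hgp t ht) (mul_le_mul_of_nonneg_left this (by positivity : 0 ≤ π / 2))
      simp only
      linarith
    · exact le_iSup (fun φ : Set.Ioo (π / 2) π => 
      ((x ^ 2 / 2 + y ^ 2 / 2 - 1 - Real.log (x * y) + Real.log (π / 2 * gg c φ) : ℝ) : EReal)) ⟨φ, hφ⟩
  · intro hle
    apply le_antisymm
    · apply iSup_le
      rintro ⟨t, ht⟩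
      rw [EReal.coe_le_coe_iff]
      have h1 := gg_le hc0 hc1 hle ⟨ht.1.le, ht.2⟩
      have h2 := mul_le_mul_of_nonneg_left h1 (by positivity : 0 ≤ π / 2)
      rw [show π / 2 * (2 / π) = 1 by field_simp] at h2
      have := Real.log_nonpos (hgp t ht).le h2
      simp only
      linarith
    · have hcont : ContinuousAt (fun t => x ^ 2 / 2 + y ^ 2 / 2 - 1 - Real.log (x * y) + Real.log (π / 2 * gg c t)) (π / 2) := by
        have h1 : π / 2 * gg c (π / 2) = 1 := by simp [gg]
        have h2 : ContinuousAt (fun t => π / 2 * gg c t) (π / 2) :=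
          continuousAt_const.mul (gg_deriv hc0 hc1 le_rfl).continuousAt
        exact continuousAt_const.add (h2.log (by rw [h1]; exact one_ne_zero))
      have ht := (continuous_coe_real_ereal.continuousAt.comp hcont).tendsto.mono_left
        (nhdsWithin_le_nhds (s := Set.Ioi (π / 2)))
      have h1 : π / 2 * gg c (π / 2) = 1 := by simp [gg]
      simp only [Function.comp_def, h1, Real.log_one, add_zero] at ht
      refine le_of_tendsto ht ?_
      filter_upwards [Ioo_mem_nhdsGT (show π / 2 < π by linarith)] with t htt
      exact le_iSup (fun φ : Set.Ioo (π / 2) π => 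
      ((x ^ 2 / 2 + y ^ 2 / 2 - 1 - Real.log (x * y) + Real.log (π / 2 * gg c φ) : ℝ) : EReal)) ⟨t, htt⟩
end
end

section
/- Fix θ ∈ [arccos(2/π), π/2), and define h₊(β) = √(β² − 1) / ( (β − cos θ)·(π + 2·arcsin(1/β)) ) for β ∈ (1, ∞). Then h₊ is strictly increasing on (1, ∞), h₊(β) → 1/π as β → ∞, and consequently sup_{β > 1} h₊(β) = 1/π, the supremum not being attained. -/
open Real Filter

lemma aux_D (t : ℝ) (h0 : 0 < t) (h1 : t < π / 2) :
    0 < 2 * cos t + (π + 2 * t) * sin t - 2 - 4 / π * t - 4 / π * (sin t * cos t) := by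
  have hpi := Real.pi_gt_three
  have hpp : 8 / π < π := by
    rw [div_lt_iff₀ Real.pi_pos]; nlinarith
  have hd : ∀ x : ℝ, HasDerivAt (fun t : ℝ => 2 * cos t + (π + 2 * t) * sin t - 2 - 4 / π * t
      - 4 / π * (sin t * cos t)) (cos x * (π + 2 * x - 8 / π * cos x)) x := by
    intro x
    have e1 := (Real.hasDerivAt_cos x).const_mul 2
    have e2 := (((hasDerivAt_id' x).const_mul 2).const_add π).mul (Real.hasDerivAt_sin x)
    have e3 := (hasDerivAt_id' x).const_mul (4 / π)
    have e4 := ((Real.hasDerivAt_sin x).mul (Real.hasDerivAt_cos x)).const_mul (4 / π)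
    refine HasDerivAt.congr_deriv ((((e1.add e2).sub_const 2).sub e3).sub e4) ?_
    have := Real.sin_sq_add_cos_sq x
    have h2 : sin x * -sin x = cos x ^ 2 - 1 := by linarith
    rw [h2]; ring
  have hm : StrictMonoOn (fun t : ℝ => 2 * cos t + (π + 2 * t) * sin t - 2 - 4 / π * t
      - 4 / π * (sin t * cos t)) (Set.Icc 0 (π / 2)) := by
    apply strictMonoOn_of_deriv_pos (convex_Icc _ _)
    · exact fun x _ => (hd x).continuousAt.continuousWithinAt
    · intro x hx
      rw [interior_Icc] at hx
      rw [(hd x).deriv]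
      have hc : 0 < cos x := Real.cos_pos_of_mem_Ioo ⟨by linarith [hx.1], hx.2⟩
      have : 8 / π * cos x ≤ 8 / π := mul_le_of_le_one_right (by positivity) (Real.cos_le_one x)
      exact mul_pos hc (by linarith [hx.1])
  have := hm (Set.left_mem_Icc.2 (by positivity)) ⟨h0.le, h1.le⟩ h0
  simpa using this

lemma aux_anti (c : ℝ) (hc0 : 0 < c) (hc1 : c ≤ 2 / π) :
    StrictAntiOn (fun t : ℝ => cos t / ((1 - c * sin t) * (π + 2 * t))) (Set.Ico 0 (π / 2)) := by
  have hpi := Real.pi_gt_three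
  have hc : c < 1 := hc1.trans_lt (by rw [div_lt_one Real.pi_pos]; linarith)
  have hA : ∀ x : ℝ, 0 < 1 - c * sin x := fun x => by
    nlinarith [Real.sin_le_one x]
  have hd : ∀ x : ℝ, 0 ≤ x → HasDerivAt (fun t : ℝ => cos t / ((1 - c * sin t) * (π + 2 * t)))
      ((-sin x * ((1 - c * sin x) * (π + 2 * x)) - cos x * ((-(c * cos x)) * (π + 2 * x)
        + (1 - c * sin x) * (2 * 1))) / ((1 - c * sin x) * (π + 2 * x)) ^ 2) x := by
    intro x hx
    have e1 := ((Real.hasDerivAt_sin x).const_mul c).const_sub 1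
    have e2 := ((hasDerivAt_id' x).const_mul 2).const_add π
    exact (Real.hasDerivAt_cos x).div (e1.mul e2)
      (mul_pos (hA x) (by linarith)).ne'
  apply strictAntiOn_of_deriv_neg (convex_Ico _ _)
  · exact fun x hx => (hd x hx.1).continuousAt.continuousWithinAt
  · intro x hx
    rw [interior_Ico] at hx
    rw [(hd x hx.1.le).deriv]
    have hx1 := hx.1
    apply div_neg_of_neg_of_pos _ (pow_pos (mul_pos (hA x) (by linarith)) 2)
    have hcos : 0 < cos x := Real.cos_pos_of_mem_Ioo ⟨by linarith [hx.1], hx.2⟩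
    have hsin : 0 < sin x := Real.sin_pos_of_pos_of_lt_pi hx.1 (by linarith [hx.2])
    have hD := aux_D x hx.1 hx.2
    have hE : c * (π + 2 * x + 2 * (sin x * cos x)) ≤ 2 / π * (π + 2 * x + 2 * (sin x * cos x)) :=
      mul_le_mul_of_nonneg_right hc1 (by positivity)
    have hF : 2 / π * (π + 2 * x + 2 * (sin x * cos x))
        = 2 + 4 / π * x + 4 / π * (sin x * cos x) := by
      field_simp; ring
    have h2 : sin x * sin x = 1 - cos x ^ 2 := by linarith [Real.sin_sq_add_cos_sq x]
    have : -sin x * ((1 - c * sin x) * (π + 2 * x)) - cos x * ((-(c * cos x)) * (π + 2 * x)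
        + (1 - c * sin x) * (2 * 1)) = c * (π + 2 * x + 2 * (sin x * cos x))
        - (2 * cos x + (π + 2 * x) * sin x) := by
      linear_combination c * (π + 2 * x) * h2
    rw [this]; linarith

lemma aux_eq_s12 (c β : ℝ) (hβ : 1 < β) :
    Real.sqrt (β ^ 2 - 1) / ((β - c) * (π + 2 * Real.arcsin (1 / β))) =
    (fun t : ℝ => cos t / ((1 - c * sin t) * (π + 2 * t))) (arcsin (1 / β)) := by
  have hb : 0 < β := by linarith
  have h1 : 1 / β ≤ 1 := by rw [div_le_one hb]; exact hβ.le
  have h0 : 0 < 1 / β := by positivity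
  simp only [Real.cos_arcsin]
  rw [Real.sin_arcsin (by linarith) h1]
  have e1 : β ^ 2 - 1 = β ^ 2 * (1 - (1 / β) ^ 2) := by field_simp
  have e2 : β - c = β * (1 - c * (1 / β)) := by field_simp
  rw [e1, e2, Real.sqrt_mul (by positivity), Real.sqrt_sq hb.le, mul_assoc β,
    mul_div_mul_left _ _ hb.ne']

lemma aux_mem (β : ℝ) (hβ : 1 < β) : 0 < arcsin (1 / β) ∧ arcsin (1 / β) < π / 2 := by
  have hb : 0 < β := by linarith
  refine ⟨Real.arcsin_pos.2 (by positivity), Real.arcsin_lt_pi_div_two.2 ?_⟩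
  rw [div_lt_one hb]; exact hβ

theorem hplus_strictMono_sup (θ : ℝ) (hθ : θ ∈ Set.Ico (Real.arccos (2 / π)) (π / 2)) :
    StrictMonoOn
        (fun β : ℝ =>
          Real.sqrt (β ^ 2 - 1) / ((β - Real.cos θ) * (π + 2 * Real.arcsin (1 / β))))
        (Set.Ioi 1) ∧
    Tendsto
        (fun β : ℝ =>
          Real.sqrt (β ^ 2 - 1) / ((β - Real.cos θ) * (π + 2 * Real.arcsin (1 / β))))
        atTop (nhds (1 / π)) ∧
    IsLUB
        ((fun β : ℝ =>
          Real.sqrt (β ^ 2 - 1) / ((β - Real.cos θ) * (π + 2 * Real.arcsin (1 / β))))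
            '' Set.Ioi 1) (1 / π) ∧
    (1 / π) ∉
        (fun β : ℝ =>
          Real.sqrt (β ^ 2 - 1) / ((β - Real.cos θ) * (π + 2 * Real.arcsin (1 / β))))
            '' Set.Ioi 1 := by
  have hpi := Real.pi_gt_three
  have hc0 : 0 < cos θ := Real.cos_pos_of_mem_Ioo
    ⟨by linarith [hθ.1, Real.arccos_nonneg (2 / π)], hθ.2⟩
  have hc1 : cos θ ≤ 2 / π := by
    have h := Real.cos_le_cos_of_nonneg_of_le_pi (Real.arccos_nonneg (2 / π))
      (by linarith [hθ.2]) hθ.1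
    rwa [Real.cos_arccos (by linarith [show 0 < 2 / π by positivity])
      (by rw [div_le_one Real.pi_pos]; linarith)] at h
  generalize cos θ = c at hc0 hc1
  have hF := aux_anti c hc0 hc1
  have hlt : ∀ β : ℝ, 1 < β →
      Real.sqrt (β ^ 2 - 1) / ((β - c) * (π + 2 * Real.arcsin (1 / β))) < 1 / π := by
    intro β hβ
    rw [aux_eq_s12 c β hβ]
    have hm := aux_mem β hβ
    have := hF (Set.left_mem_Ico.2 (by positivity)) ⟨hm.1.le, hm.2⟩ hm.1
    simpa using this
  have hT : Tendsto (fun β : ℝ =>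
      Real.sqrt (β ^ 2 - 1) / ((β - c) * (π + 2 * Real.arcsin (1 / β)))) atTop (nhds (1 / π)) := by
    have h1 : Tendsto (fun β : ℝ => arcsin (1 / β)) atTop (nhds 0) := by
      have h := (Real.continuous_arcsin.tendsto 0).comp
        (tendsto_inv_atTop_zero : Tendsto (fun x : ℝ => x⁻¹) atTop (nhds 0))
      simpa [Function.comp_def] using h
    have h2 : ContinuousAt (fun t : ℝ => cos t / ((1 - c * sin t) * (π + 2 * t))) 0 := by
      apply ContinuousAt.div
      · fun_prop
      · fun_prop
      · simp [Real.pi_ne_zero]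
    have h3 := h2.tendsto.comp h1
    have h4 : cos 0 / ((1 - c * sin 0) * (π + 2 * 0)) = 1 / π := by simp
    rw [h4] at h3
    refine h3.congr' ?_
    filter_upwards [eventually_gt_atTop 1] with β hβ
    exact (aux_eq_s12 c β hβ).symm
  refine ⟨?_, hT, ⟨?_, ?_⟩, ?_⟩
  · intro a ha b hb hab
    have ha' : 1 < a := ha
    have hb' : 1 < b := hb
    have hma := aux_mem a ha
    have hmb := aux_mem b hb
    simp only
    rw [aux_eq_s12 c a ha, aux_eq_s12 c b hb]
    apply hF ⟨hmb.1.le, hmb.2⟩ ⟨hma.1.le, hma.2⟩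
    have h0 : 0 < 1 / b := by positivity
    have h1 : 1 / a ≤ 1 := by rw [div_le_one (by linarith)]; exact ha'.le
    exact Real.strictMonoOn_arcsin.lt_iff_lt
      ⟨by linarith, by rw [div_le_one (by linarith)]; exact hb'.le⟩
      ⟨by linarith [show 0 < 1 / a by positivity], h1⟩ |>.2
      (one_div_lt_one_div_of_lt (by linarith) hab)
  · rintro _ ⟨β, hβ, rfl⟩
    exact (hlt β hβ).le
  · intro b hb
    refine le_of_tendsto hT ?_
    filter_upwards [eventually_gt_atTop 1] with β hβ
    exact hb ⟨β, hβ, rfl⟩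
  · rintro ⟨β, hβ, h⟩
    exact (hlt β hβ).ne h
end

section
/- Fix θ ∈ [π/3, π/2), and define h₋(β) = √(β² − 1) / ( (cos θ + β)·arccos(1/β) ) for β ∈ (1, ∞). Then h₋ is strictly decreasing on (1, ∞), h₋(β) → 1/(1 + cos θ) as β → 1⁺, and consequently sup_{β > 1} h₋(β) = 1/(1 + cos θ), the supremum not being attained. -/
open Real Filter

lemma aux_F (c : ℝ) (hc : 0 < c) (hc2 : c ≤ 1/2) (t : ℝ) (ht : 0 < t) (ht2 : t < π / 2) :
    0 < sin t + c * (sin t * cos t) - t * cos t - c * t := by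
  have hd : ∀ x : ℝ, HasDerivAt (fun t : ℝ => sin t + c * (sin t * cos t) - t * cos t - c * t)
      (cos x + c * (cos x * cos x + sin x * (-sin x)) - (1 * cos x + x * (-sin x)) - c * 1) x := by
    intro x
    exact ((((hasDerivAt_sin x).add (((hasDerivAt_sin x).mul (hasDerivAt_cos x)).const_mul c)).sub
      ((hasDerivAt_id x).mul (hasDerivAt_cos x))).sub ((hasDerivAt_id x).const_mul c))
  have hm : StrictMonoOn (fun t : ℝ => sin t + c * (sin t * cos t) - t * cos t - c * t)
      (Set.Icc 0 (π / 2)) := by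
    apply strictMonoOn_of_deriv_pos (convex_Icc _ _)
    · exact fun x _ => (hd x).continuousAt.continuousWithinAt
    · intro x hx
      rw [interior_Icc] at hx
      rw [(hd x).deriv]
      have h1 : 0 < sin x := sin_pos_of_pos_of_lt_pi hx.1 (by linarith [hx.2, pi_pos])
      have h2 : sin x < x := sin_lt hx.1
      have h3 := sin_sq_add_cos_sq x
      have h4 : 0 < x - 2 * c * sin x := by nlinarith
      have h5 := mul_pos h1 h4
      have h6 : cos x * cos x = 1 - sin x * sin x := by linarith
      rw [h6]
      linarith
  have := hm (Set.left_mem_Icc.2 (by positivity)) (Set.mem_Icc.2 ⟨ht.le, ht2.le⟩) ht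
  simpa using this

lemma aux_g (c : ℝ) (hc : 0 < c) (hc2 : c ≤ 1/2) :
    StrictAntiOn (fun t : ℝ => sinc t / (1 + c * cos t)) (Set.Icc 0 (π / 2)) := by
  have hpos : ∀ x : ℝ, 0 < 1 + c * cos x := by
    intro x; nlinarith [neg_one_le_cos x]
  apply strictAntiOn_of_deriv_neg (convex_Icc _ _)
  · apply Continuous.continuousOn
    exact continuous_sinc.div (by fun_prop) (fun x => (hpos x).ne')
  · intro x hx
    rw [interior_Icc] at hx
    have hx0 : 0 < x := hx.1
    have he : (fun t : ℝ => sinc t / (1 + c * cos t)) =ᶠ[nhds x]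
        (fun t : ℝ => sin t / (t * (1 + c * cos t))) := by
      filter_upwards [lt_mem_nhds hx0] with y hy
      rw [sinc_of_ne_zero hy.ne', div_div]
    have hne : x * (1 + c * cos x) ≠ 0 := (mul_pos hx0 (hpos x)).ne'
    have hd : HasDerivAt (fun t : ℝ => sin t / (t * (1 + c * cos t))) _ x :=
      (hasDerivAt_sin x).div ((hasDerivAt_id x).mul
        (((hasDerivAt_cos x).const_mul c).const_add 1)) hne
    rw [he.deriv_eq, hd.deriv]
    apply div_neg_of_neg_of_pos
    · have hF := aux_F c hc hc2 x hx0 hx.2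
      have h6 : cos x * cos x = 1 - sin x * sin x := by linarith [sin_sq_add_cos_sq x]
      have : cos x * (x * (1 + c * cos x)) - sin x * (1 * (1 + c * cos x) + x * (c * -sin x))
          = -(sin x + c * (sin x * cos x) - x * cos x - c * x) := by
        linear_combination c * x * h6
      simp only [Pi.mul_apply, id] at *
      linarith
    · have := pow_pos (mul_pos hx0 (hpos x)) 2
      simpa using this

lemma aux_h (c : ℝ) (β : ℝ) (hβ : 1 < β) :
    Real.sqrt (β ^ 2 - 1) / ((c + β) * Real.arccos (1 / β)) =
      sinc (arccos (1 / β)) / (1 + c * cos (arccos (1 / β))) := by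
  have hb : 0 < β := by linarith
  have h1 : 1 / β < 1 := by rw [div_lt_one hb]; exact hβ
  have h0 : 0 < 1 / β := by positivity
  have ha : 0 < arccos (1 / β) := arccos_pos.2 h1
  rw [sinc_of_ne_zero ha.ne', cos_arccos (by linarith) h1.le, sin_arccos]
  have : 1 - (1 / β) ^ 2 = (β ^ 2 - 1) / β ^ 2 := by field_simp
  rw [this, sqrt_div' _ (by positivity), sqrt_sq hb.le, div_div, div_div]
  congr 1
  field_simp
  ring

theorem hminus_strictAnti_sup (θ : ℝ) (hθ : θ ∈ Set.Ico (π / 3) (π / 2)) :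
    StrictAntiOn
        (fun β : ℝ =>
          Real.sqrt (β ^ 2 - 1) / ((Real.cos θ + β) * Real.arccos (1 / β)))
        (Set.Ioi 1) ∧
    Tendsto
        (fun β : ℝ =>
          Real.sqrt (β ^ 2 - 1) / ((Real.cos θ + β) * Real.arccos (1 / β)))
        (nhdsWithin 1 (Set.Ioi 1)) (nhds (1 / (1 + Real.cos θ))) ∧
    IsLUB
        ((fun β : ℝ =>
          Real.sqrt (β ^ 2 - 1) / ((Real.cos θ + β) * Real.arccos (1 / β)))
            '' Set.Ioi 1) (1 / (1 + Real.cos θ)) ∧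
    (1 / (1 + Real.cos θ)) ∉
        (fun β : ℝ =>
          Real.sqrt (β ^ 2 - 1) / ((Real.cos θ + β) * Real.arccos (1 / β)))
            '' Set.Ioi 1 := by
  have hc : 0 < cos θ := cos_pos_of_mem_Ioo ⟨by linarith [hθ.1, pi_pos], hθ.2⟩
  have hc2 : cos θ ≤ 1 / 2 := by
    rw [← cos_pi_div_three]
    exact cos_le_cos_of_nonneg_of_le_pi (by positivity) (by linarith [hθ.2, pi_pos]) hθ.1
  have hg := aux_g _ hc hc2
  have hmem : ∀ β : ℝ, 1 < β → 0 < arccos (1 / β) ∧ arccos (1 / β) < π / 2 := by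
    intro β hβ
    have hb : 0 < β := by linarith
    exact ⟨arccos_pos.2 (by rw [div_lt_one hb]; exact hβ), arccos_lt_pi_div_two.2 (by positivity)⟩
  have hlt : ∀ β : ℝ, 1 < β →
      Real.sqrt (β ^ 2 - 1) / ((Real.cos θ + β) * Real.arccos (1 / β)) < 1 / (1 + cos θ) := by
    intro β hβ
    rw [aux_h _ _ hβ]
    have := hg (Set.left_mem_Icc.2 (by positivity))
      (Set.mem_Icc.2 ⟨(hmem β hβ).1.le, (hmem β hβ).2.le⟩) (hmem β hβ).1
    simpa using this
  have hT : Tendsto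
        (fun β : ℝ =>
          Real.sqrt (β ^ 2 - 1) / ((Real.cos θ + β) * Real.arccos (1 / β)))
        (nhdsWithin 1 (Set.Ioi 1)) (nhds (1 / (1 + Real.cos θ))) := by
    have hca : ContinuousAt (fun β : ℝ => sinc (arccos (1 / β)) /
        (1 + cos θ * cos (arccos (1 / β)))) 1 := by
      have h1 : ContinuousAt (fun β : ℝ => arccos (1 / β)) 1 :=
        continuous_arccos.continuousAt.comp (continuousAt_const.div continuousAt_id one_ne_zero)
      refine ContinuousAt.div (continuous_sinc.continuousAt.comp h1)
        (continuousAt_const.add (continuousAt_const.mul (continuous_cos.continuousAt.comp h1))) ?_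
      simp
      linarith
    have h2 := hca.tendsto.mono_left (nhdsWithin_le_nhds (s := Set.Ioi 1))
    simp only [div_one, arccos_one, sinc_zero, cos_zero, mul_one] at h2
    refine h2.congr' ?_
    filter_upwards [self_mem_nhdsWithin] with β hβ
    exact (aux_h _ _ hβ).symm
  refine ⟨?_, hT, ⟨?_, ?_⟩, ?_⟩
  · intro a ha b hb hab
    have ha' : 1 < a := ha
    have hb' : 1 < b := hb
    simp only
    rw [aux_h _ _ ha', aux_h _ _ hb']
    refine hg (Set.mem_Icc.2 ⟨(hmem a ha).1.le, (hmem a ha).2.le⟩)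
      (Set.mem_Icc.2 ⟨(hmem b hb).1.le, (hmem b hb).2.le⟩) ?_
    have h0 : 0 < a := by linarith
    have h0b : 0 < b := by linarith
    have h1 : 1 / b < 1 / a := one_div_lt_one_div_of_lt h0 hab
    have h2 : 1 / a ≤ 1 := by rw [div_le_one h0]; exact ha'.le
    have h3 : 0 < 1 / b := by positivity
    exact strictAntiOn_arccos (Set.mem_Icc.2 ⟨by linarith, by linarith⟩)
      (Set.mem_Icc.2 ⟨by linarith, h2⟩) h1
  · rintro _ ⟨β, hβ, rfl⟩
    exact (hlt β hβ).le
  · intro u hu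
    refine le_of_tendsto hT ?_
    filter_upwards [self_mem_nhdsWithin] with β hβ
    exact hu ⟨β, hβ, rfl⟩
  · rintro ⟨β, hβ, h⟩
    exact (hlt β hβ).ne h
end
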